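/- Let d ∈ {1,2,3}. There exists a constant C > 0 depending only on d such that for every integer n ≥ 1 (with h = 1/(n+1)), every τ > 0, and every function R : ℝ^d → ℝ that is twice continuously differentiable on a neighbourhood of [0,1]^d, | τ² ∑_{k∈{1,…,n}^d} (1+λ_k^{(h)})^{-1} ⟨R, φ_k⟩_h² − ‖R‖_Φ² | ≤ C τ² h^{2−d/2} ‖R‖_{H²}². -/

import Mathlib

open MeasureTheory ProbabilityTheory Filter

noncomputable section

/-- The closed unit cube `[0,1]^d`. -/
def cube (d : ℕ) : Set (Fin d → ℝ) := Set.Icc 0 1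

/-- Mesh size `h = 1/(n+1)`. -/
def mesh (n : ℕ) : ℝ := 1 / (n + 1)

/-- The interior grid point `x_i = i·h` associated with `i ∈ {1,…,n}^d`
(encoded by `i : Fin d → Fin n`, the multi-index being `i + 1`). -/
def gridPt (d n : ℕ) (i : Fin d → Fin n) : Fin d → ℝ :=
  fun j => ((i j : ℕ) + 1) * mesh n

/-- The `L²`-normalised Dirichlet eigenfunction
`φ_k(x) = 2^{d/2} ∏_j sin(k_j π x_j)` of `-Δ` on `(0,1)^d`, for the multi-index
`k + 1` with `k : Fin d → ℕ`. -/
def eigenFun (d : ℕ) (k : Fin d → ℕ) (x : Fin d → ℝ) : ℝ :=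
  (2 : ℝ) ^ ((d : ℝ) / 2) * ∏ j, Real.sin (((k j : ℝ) + 1) * Real.pi * x j)

/-- The Dirichlet eigenvalue `λ_k = π² ∑_j k_j²` for the multi-index `k + 1`. -/
def lamC (d : ℕ) (k : Fin d → ℕ) : ℝ :=
  Real.pi ^ 2 * ∑ j, ((k j : ℝ) + 1) ^ 2

/-- The eigenvalue `λ_k^{(h)} = (4/h²) ∑_j sin²(k_j π h / 2)` of the discretised
Dirichlet Laplacian, for `k ∈ {1,…,n}^d` encoded by `k : Fin d → Fin n`. -/
def lamD (d n : ℕ) (k : Fin d → Fin n) : ℝ :=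
  4 / mesh n ^ 2 * ∑ j, Real.sin ((((k j : ℕ) : ℝ) + 1) * Real.pi * mesh n / 2) ^ 2

/-- The discrete inner product `⟨u,v⟩_h = h^d ∑_{i∈{1,…,n}^d} u(x_i) v(x_i)`. -/
def dInner (d n : ℕ) (u v : (Fin d → ℝ) → ℝ) : ℝ :=
  mesh n ^ d * ∑ i : Fin d → Fin n, u (gridPt d n i) * v (gridPt d n i)

/-- The partial derivative `∂_j f`. -/
def pd (d : ℕ) (j : Fin d) (f : (Fin d → ℝ) → ℝ) : (Fin d → ℝ) → ℝ :=
  fun x => fderiv ℝ f x (Pi.single j 1)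

/-- The squared Sobolev norm
`‖f‖_{H²}² = ∑_{|α| ≤ 2} ∫_{(0,1)^d} |D^α f|²`, the order-two multi-indices being the
unordered pairs `j ≤ j'`. -/
def H2sq (d : ℕ) (f : (Fin d → ℝ) → ℝ) : ℝ :=
  (∫ x in cube d, f x ^ 2) + (∑ j : Fin d, ∫ x in cube d, pd d j f x ^ 2) +
    ∑ j : Fin d, ∑ j' : Fin d,
      if j ≤ j' then ∫ x in cube d, pd d j (pd d j' f) x ^ 2 else 0

/-- The squared `Φ`-stochastically weak norm
`‖f‖_Φ² = τ² ∑_{k∈(ℤ_{≥1})^d} (1+λ_k)⁻¹ (∫ f φ_k)²`. -/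
def PhiSq (d : ℕ) (τ : ℝ) (f : (Fin d → ℝ) → ℝ) : ℝ :=
  τ ^ 2 * ∑' k : Fin d → ℕ,
    (1 + lamC d k)⁻¹ * (∫ x in cube d, f x * eigenFun d k x) ^ 2

/-- `f` is twice continuously differentiable on a neighbourhood of `[0,1]^d`. -/
def C2Nbhd (d : ℕ) (f : (Fin d → ℝ) → ℝ) : Prop :=
  ∃ U : Set (Fin d → ℝ), IsOpen U ∧ cube d ⊆ U ∧ ContDiffOn ℝ 2 f U

end

theorem cube_eq_pi (d : ℕ) : cube d = Set.univ.pi fun _ => Set.Icc (0 : ℝ) 1 := by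
  rw [cube, ← Set.pi_univ_Icc]; rfl

theorem mem_cube_iff {d : ℕ} {x : Fin d → ℝ} : x ∈ cube d ↔ ∀ j, 0 ≤ x j ∧ x j ≤ 1 := by
  simp only [cube_eq_pi, Set.mem_univ_pi, Set.mem_Icc]

theorem isCompact_cube (d : ℕ) : IsCompact (cube d) := isCompact_Icc

theorem measurableSet_cube (d : ℕ) : MeasurableSet (cube d) := measurableSet_Icc

theorem mesh_pos (n : ℕ) : 0 < mesh n := by unfold mesh; positivity

theorem mesh_mul (n : ℕ) : ((n : ℝ) + 1) * mesh n = 1 := by unfold mesh; field_simp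

theorem mesh_le_one (n : ℕ) : mesh n ≤ 1 := by
  have := mesh_mul n; have := mesh_pos n; nlinarith [(Nat.cast_nonneg n : (0 : ℝ) ≤ n)]

theorem gridPt_mem_cube {d n : ℕ} (i : Fin d → Fin n) : gridPt d n i ∈ cube d := by
  rw [mem_cube_iff]
  intro j
  have h1 : ((i j : ℕ) : ℝ) + 1 ≤ n := by exact_mod_cast (i j).2
  have := mesh_mul n
  have := mesh_pos n
  constructor
  · unfold gridPt; positivity
  · unfold gridPt; nlinarith

/-- A function that is `C²` near the cube agrees near the cube with a globally `C²` function. -/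
theorem C2Nbhd.exists_contDiff {d : ℕ} {R : (Fin d → ℝ) → ℝ} (hR : C2Nbhd d R) :
    ∃ S : (Fin d → ℝ) → ℝ, ContDiff ℝ 2 S ∧ ∀ x ∈ cube d, S =ᶠ[nhds x] R := by
  obtain ⟨U, hU, hcU, hRU⟩ := hR
  obtain ⟨t, ht, hct, htU⟩ := exists_compact_between (isCompact_cube d) hU hcU
  obtain ⟨f, hf1, hf0, -⟩ := exists_contMDiffMap_one_nhds_of_subset_interior (n := 2)
    (modelWithCornersSelf ℝ (Fin d → ℝ)) (isCompact_cube d).isClosed hct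
  have hfc : ContDiff ℝ 2 f := f.contMDiff.contDiff
  refine ⟨fun x => f x * R x, ?_, ?_⟩
  · rw [contDiff_iff_contDiffAt]
    intro x
    by_cases hx : x ∈ U
    · exact hfc.contDiffAt.mul (hRU.contDiffAt (hU.mem_nhds hx))
    · have : (fun x => f x * R x) =ᶠ[nhds x] fun _ => 0 := by
        filter_upwards [ht.isClosed.isOpen_compl.mem_nhds (fun h => hx (htU h))] with y hy
        rw [hf0 y hy, zero_mul]
      exact contDiffAt_const.congr_of_eventuallyEq this
  · intro x hx
    filter_upwards [eventually_nhdsSet_iff_forall.1 hf1 x hx] with y hy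
    rw [hy, one_mul]

theorem pd_congr {d : ℕ} {f g : (Fin d → ℝ) → ℝ} {x : Fin d → ℝ} (h : f =ᶠ[nhds x] g)
    (j : Fin d) : pd d j f =ᶠ[nhds x] pd d j g := by
  filter_upwards [h.fderiv (𝕜 := ℝ)] with y hy
  simp only [pd, hy]

theorem H2sq_congr {d : ℕ} {f g : (Fin d → ℝ) → ℝ} (h : ∀ x ∈ cube d, f =ᶠ[nhds x] g) :
    H2sq d f = H2sq d g := by
  have h0 : ∀ {u v : (Fin d → ℝ) → ℝ}, (∀ x ∈ cube d, u =ᶠ[nhds x] v) →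
      ∫ x in cube d, u x ^ 2 = ∫ x in cube d, v x ^ 2 := fun huv =>
    setIntegral_congr_fun (measurableSet_cube d) fun x hx => by
      simp only [(huv x hx).self_of_nhds]
  unfold H2sq
  rw [h0 h]
  congr 1
  · congr 1
    exact Finset.sum_congr rfl fun j _ => h0 fun x hx => pd_congr (h x hx) j
  · refine Finset.sum_congr rfl fun j _ => Finset.sum_congr rfl fun j' _ => ?_
    rw [h0 fun x hx => pd_congr (pd_congr (h x hx) j') j]

theorem PhiSq_congr {d : ℕ} {τ : ℝ} {f g : (Fin d → ℝ) → ℝ}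
    (h : ∀ x ∈ cube d, f =ᶠ[nhds x] g) : PhiSq d τ f = PhiSq d τ g := by
  unfold PhiSq
  congr 1
  refine tsum_congr fun k => ?_
  have : ∫ x in cube d, f x * eigenFun d k x = ∫ x in cube d, g x * eigenFun d k x :=
    setIntegral_congr_fun (measurableSet_cube d) fun x hx => by
      simp only [(h x hx).self_of_nhds]
  rw [this]

theorem dInner_congr {d n : ℕ} {f g φ : (Fin d → ℝ) → ℝ}
    (h : ∀ x ∈ cube d, f =ᶠ[nhds x] g) : dInner d n f φ = dInner d n g φ := by
  unfold dInner
  congr 1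
  exact Finset.sum_congr rfl fun i _ => by rw [(h _ (gridPt_mem_cube i)).self_of_nhds]

theorem pd_comm {d : ℕ} {R : (Fin d → ℝ) → ℝ} (hR : ContDiff ℝ 2 R) (j j' : Fin d) :
    pd d j (pd d j' R) = pd d j' (pd d j R) := by
  have key : ∀ (i i' : Fin d) x, pd d i (pd d i' R) x =
      fderiv ℝ (fderiv ℝ R) x (Pi.single i 1) (Pi.single i' 1) := by
    intro i i' x
    have hd : DifferentiableAt ℝ (fderiv ℝ R) x :=
      ((hR.fderiv_right (m := 1) (by norm_num)).differentiable (by norm_num)) x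
    unfold pd
    rw [fderiv_clm_apply hd (differentiableAt_const _)]
    simp
  funext x
  rw [key, key]
  exact (hR.contDiffAt.isSymmSndFDerivAt (by simp)).eq _ _

theorem contDiff_pd {d : ℕ} {m n : WithTop ℕ∞} {R : (Fin d → ℝ) → ℝ} (hR : ContDiff ℝ n R)
    (h : m + 1 ≤ n) (j : Fin d) : ContDiff ℝ m (pd d j R) :=
  (hR.fderiv_right h).clm_apply contDiff_const

theorem continuous_pd {d : ℕ} {R : (Fin d → ℝ) → ℝ} (hR : ContDiff ℝ 2 R) (j : Fin d) :
    Continuous (pd d j R) :=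
  (contDiff_pd (m := 1) hR (by norm_num) j).continuous

theorem continuous_pd_pd {d : ℕ} {R : (Fin d → ℝ) → ℝ} (hR : ContDiff ℝ 2 R) (j j' : Fin d) :
    Continuous (pd d j (pd d j' R)) :=
  (contDiff_pd (m := 0) (contDiff_pd (m := 1) hR (by norm_num) j') (by norm_num) j).continuous

theorem integrableOn_cube {d : ℕ} {f : (Fin d → ℝ) → ℝ} (hf : Continuous f) :
    IntegrableOn f (cube d) := hf.continuousOn.integrableOn_compact (isCompact_cube d)

/-- The full second-order seminorm, summed over ordered pairs of indices, is controlled by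
`H2sq`. -/
theorem sum_pd_pd_le_H2sq {d : ℕ} {R : (Fin d → ℝ) → ℝ} (hR : ContDiff ℝ 2 R) :
    (∫ x in cube d, R x ^ 2) + (∑ j, ∫ x in cube d, pd d j R x ^ 2) +
      ∑ j, ∑ j', ∫ x in cube d, pd d j (pd d j' R) x ^ 2 ≤ 2 * H2sq d R := by
  set a : Fin d → Fin d → ℝ := fun j j' => ∫ x in cube d, pd d j (pd d j' R) x ^ 2 with ha
  have a0 : ∀ j j', 0 ≤ a j j' := fun j j' => integral_nonneg fun x => sq_nonneg _
  have asymm : ∀ j j', a j j' = a j' j := fun j j' => by simp only [ha, pd_comm hR j j']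
  have h1 : ∑ j, ∑ j', a j j' ≤ 2 * ∑ j, ∑ j', if j ≤ j' then a j j' else 0 := by
    have h2 : ∑ j, ∑ j', (if j ≤ j' then a j j' else 0) =
        ∑ j, ∑ j', if j' ≤ j then a j j' else 0 := by
      rw [Finset.sum_comm]
      exact Finset.sum_congr rfl fun j _ => Finset.sum_congr rfl fun j' _ => by rw [asymm]
    rw [two_mul]
    nth_rewrite 2 [h2]
    simp only [← Finset.sum_add_distrib]
    refine Finset.sum_le_sum fun j _ => Finset.sum_le_sum fun j' _ => ?_
    have := a0 j j'
    rcases le_total j j' with h | h <;> simp only [h, if_true] <;> split_ifs <;> linarith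
  have h3 : 0 ≤ ∫ x in cube d, R x ^ 2 := integral_nonneg fun x => sq_nonneg _
  have h4 : 0 ≤ ∑ j, ∫ x in cube d, pd d j R x ^ 2 :=
    Finset.sum_nonneg fun j _ => integral_nonneg fun x => sq_nonneg _
  unfold H2sq
  linarith

theorem sq_integral_le_integral_sq {w : ℝ → ℝ} (hw : Continuous w) :
    (∫ s in (0 : ℝ)..1, w s) ^ 2 ≤ ∫ s in (0 : ℝ)..1, w s ^ 2 := by
  set c := ∫ s in (0 : ℝ)..1, w s with hc
  have h0 : 0 ≤ ∫ s in (0 : ℝ)..1, (w s - c) ^ 2 :=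
    intervalIntegral.integral_nonneg zero_le_one fun s _ => sq_nonneg _
  have h1 : ∫ s in (0 : ℝ)..1, (w s - c) ^ 2 =
      (∫ s in (0 : ℝ)..1, w s ^ 2) - 2 * c * c + c ^ 2 := by
    have : ∀ s, (w s - c) ^ 2 = w s ^ 2 - 2 * c * w s + c ^ 2 := fun s => by ring
    simp only [this]
    rw [intervalIntegral.integral_add, intervalIntegral.integral_sub,
      intervalIntegral.integral_const_mul, ← hc]
    · simp
    all_goals exact Continuous.intervalIntegrable (by fun_prop) _ _
  nlinarith

theorem fderiv_eq_sum_pd {d : ℕ} (u : (Fin d → ℝ) → ℝ) (x v : Fin d → ℝ) :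
    fderiv ℝ u x v = ∑ j, pd d j u x * v j := by
  conv_lhs => rw [← Finset.univ_sum_single v]
  rw [map_sum]
  refine Finset.sum_congr rfl fun j _ => ?_
  have : (Pi.single j (v j) : Fin d → ℝ) = v j • Pi.single j 1 := by
    rw [← Pi.single_smul, smul_eq_mul, mul_one]
  rw [this, map_smul, smul_eq_mul, mul_comm]; rfl

theorem hasDerivAt_comp_sq_smul {d : ℕ} {u : (Fin d → ℝ) → ℝ} (hu : Differentiable ℝ u)
    (p v : Fin d → ℝ) (s : ℝ) :
    HasDerivAt (fun s : ℝ => u (p + s ^ 2 • v))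
      (2 * s * ∑ j, pd d j u (p + s ^ 2 • v) * v j) s := by
  have h1 : HasDerivAt (fun s : ℝ => p + s ^ 2 • v) ((2 * s) • v) s := by
    simpa using ((hasDerivAt_pow 2 s).smul_const v).const_add p
  have h2 := (hu (p + s ^ 2 • v)).hasFDerivAt.comp_hasDerivAt s h1
  rw [map_smul, smul_eq_mul, fderiv_eq_sum_pd] at h2
  exact h2

/-- The second-order Taylor formula about `p`, expanded backwards from the other endpoint. -/
theorem taylor_backward {d : ℕ} {R : (Fin d → ℝ) → ℝ} (hR : ContDiff ℝ 2 R)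
    (p v : Fin d → ℝ) :
    R p - R (p + v) = -(∑ j, pd d j R (p + v) * v j) +
      ∫ s in (0 : ℝ)..1, 2 * s ^ 3 *
        ∑ j, (∑ j', pd d j' (pd d j R) (p + s ^ 2 • v) * v j') * v j := by
  have hd : Differentiable ℝ R := hR.differentiable (by norm_num)
  have hd' : ∀ j, Differentiable ℝ (pd d j R) := fun j =>
    (contDiff_pd (m := 1) hR (by norm_num) j).differentiable (by norm_num)
  have hc : ∀ j j', Continuous (pd d j' (pd d j R)) := fun j j' => continuous_pd_pd hR j' j
  have hF : ∀ s ∈ Set.uIcc (0 : ℝ) 1, HasDerivAt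
      (fun s : ℝ => R (p + s ^ 2 • v) - s ^ 2 * ∑ j, pd d j R (p + s ^ 2 • v) * v j)
      (-(2 * s ^ 3 * ∑ j, (∑ j', pd d j' (pd d j R) (p + s ^ 2 • v) * v j') * v j)) s := by
    intro s _
    have h1 := hasDerivAt_comp_sq_smul hd p v s
    have h2 : HasDerivAt (fun s : ℝ => ∑ j, pd d j R (p + s ^ 2 • v) * v j)
        (∑ j, (2 * s * ∑ j', pd d j' (pd d j R) (p + s ^ 2 • v) * v j') * v j) s := by
      exact HasDerivAt.fun_sum fun j _ => (hasDerivAt_comp_sq_smul (hd' j) p v s).mul_const (v j)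
    have h3 := h1.sub ((hasDerivAt_pow 2 s).mul h2)
    have h4 : ∑ j, (2 * s * ∑ j', pd d j' (pd d j R) (p + s ^ 2 • v) * v j') * v j =
        2 * s * ∑ j, (∑ j', pd d j' (pd d j R) (p + s ^ 2 • v) * v j') * v j := by
      rw [Finset.mul_sum]
      exact Finset.sum_congr rfl fun j _ => by ring
    rw [h4] at h3
    refine HasDerivAt.congr_deriv h3 ?_
    push_cast
    ring
  have h := intervalIntegral.integral_eq_sub_of_hasDerivAt hF
    (Continuous.intervalIntegrable (by fun_prop) _ _)
  rw [intervalIntegral.integral_neg] at h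
  simp at h
  linarith

theorem integral_comp_homothety_le {d : ℕ} {W : (Fin d → ℝ) → ℝ} (hW0 : ∀ x, 0 ≤ W x)
    {p : Fin d → ℝ} {Q : Set (Fin d → ℝ)} (hQ : MeasurableSet Q) (hWQ : IntegrableOn W Q)
    (hstar : StarConvex ℝ p Q) {t : ℝ} (ht0 : 0 < t) (ht1 : t ≤ 1) :
    t ^ d * ∫ y in Q, W (p + t • (y - p)) ≤ ∫ y in Q, W y := by
  have hI : Integrable (Q.indicator W) := (integrable_indicator_iff hQ).2 hWQ
  have hI' : Integrable fun y => Q.indicator W (p + t • (y - p)) :=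
    ((hI.comp_add_left p).comp_smul ht0.ne').comp_sub_right p
  have h1 : ∫ y in Q, W (p + t • (y - p)) ≤ ∫ y, Q.indicator W (p + t • (y - p)) := by
    rw [← integral_indicator hQ]
    refine integral_mono_of_nonneg ?_ hI' ?_
    · exact ae_of_all _ fun y => Set.indicator_nonneg (fun _ _ => hW0 _) _
    · refine ae_of_all _ fun y => ?_
      by_cases hy : y ∈ Q
      · have : p + t • (y - p) ∈ Q := by
          have := hstar hy (by linarith : 0 ≤ 1 - t) ht0.le (by ring)
          convert this using 1
          module
        simp [hy, this]
      · simp only [Set.indicator_of_notMem hy]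
        exact Set.indicator_nonneg (fun _ _ => hW0 _) _
  have h2 : ∫ y, Q.indicator W (p + t • (y - p)) = (t ^ d)⁻¹ * ∫ y in Q, W y := by
    rw [integral_sub_right_eq_self (fun y => Q.indicator W (p + t • y)) p,
      Measure.integral_comp_smul volume (fun y => Q.indicator W (p + y)) t,
      integral_add_left_eq_self (Q.indicator W) p, integral_indicator hQ, smul_eq_mul,
      abs_of_pos (by positivity)]
    simp
  calc _ ≤ t ^ d * ((t ^ d)⁻¹ * ∫ y in Q, W y) := by rw [← h2]; gcongr
    _ = _ := by field_simp

/-- Mean-square oscillation of a `C²` function about the centre of a bounded star-shaped set, in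
dimension at most three. -/
theorem integral_sub_sq_le {d : ℕ} (hd : d ≤ 3) {R : (Fin d → ℝ) → ℝ} (hR : ContDiff ℝ 2 R)
    {p : Fin d → ℝ} {Q : Set (Fin d → ℝ)} (hQ : MeasurableSet Q) (hstar : StarConvex ℝ p Q)
    {r : ℝ} (hQr : ∀ y ∈ Q, ∀ j, |y j - p j| ≤ r) :
    ∫ y in Q, (R p - R y) ^ 2 ≤
      2 * d * r ^ 2 * (∫ y in Q, ∑ j, pd d j R y ^ 2) +
        8 * d ^ 2 * r ^ 4 * ∫ y in Q, ∑ j, ∑ j', pd d j' (pd d j R) y ^ 2 := by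
  have hRc : Continuous R := hR.continuous
  have hc1 : ∀ j, Continuous (pd d j R) := continuous_pd hR
  have hc2 : ∀ j j', Continuous (pd d j' (pd d j R)) := fun j j' => continuous_pd_pd hR j' j
  set W : (Fin d → ℝ) → ℝ := fun y => ∑ j, ∑ j', pd d j' (pd d j R) y ^ 2 with hW
  have hWc : Continuous W := by fun_prop
  have hW0 : ∀ y, 0 ≤ W y := fun y =>
    Finset.sum_nonneg fun j _ => Finset.sum_nonneg fun j' _ => sq_nonneg _
  set K : Set (Fin d → ℝ) := Set.Icc (fun j => p j - r) (fun j => p j + r) with hK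
  have hQK : Q ⊆ K := fun y hy => by
    refine ⟨fun j => ?_, fun j => ?_⟩ <;> have := abs_le.1 (hQr y hy j) <;> dsimp only <;>
      linarith
  have hInt : ∀ {f : (Fin d → ℝ) → ℝ}, Continuous f → IntegrableOn f Q := fun hf =>
    (hf.continuousOn.integrableOn_compact isCompact_Icc).mono_set hQK
  have hpt : ∀ y ∈ Q, (R p - R y) ^ 2 ≤ 2 * d * r ^ 2 * (∑ j, pd d j R y ^ 2) +
      8 * d ^ 2 * r ^ 4 * ∫ s in (0 : ℝ)..1, s ^ 6 * W (p + s ^ 2 • (y - p)) := by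
    intro y hy
    set v := y - p with hv
    have hvr : ∀ j, v j ^ 2 ≤ r ^ 2 := fun j => by
      have := hQr y hy j
      rw [← sq_abs]
      exact pow_le_pow_left₀ (abs_nonneg _) this 2
    have hpv : p + v = y := by rw [hv]; abel
    have ht := taylor_backward hR p v
    rw [hpv] at ht
    rw [ht]
    set L := ∑ j, pd d j R y * v j
    set G : ℝ → ℝ := fun s => ∑ j, (∑ j', pd d j' (pd d j R) (p + s ^ 2 • v) * v j') * v j
      with hG
    have hGc : Continuous G := by fun_prop
    have hL : L ^ 2 ≤ d * r ^ 2 * ∑ j, pd d j R y ^ 2 := by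
      refine (sq_sum_le_card_mul_sum_sq).trans ?_
      rw [Finset.card_univ, Fintype.card_fin, mul_assoc]
      gcongr
      rw [Finset.mul_sum]
      refine Finset.sum_le_sum fun j _ => ?_
      rw [mul_pow]
      nlinarith [hvr j, sq_nonneg (pd d j R y)]
    have hG2 : ∀ s, G s ^ 2 ≤ d ^ 2 * r ^ 4 * W (p + s ^ 2 • v) := by
      intro s
      refine (sq_sum_le_card_mul_sum_sq).trans ?_
      rw [Finset.card_univ, Fintype.card_fin, pow_two (d : ℝ), mul_assoc, mul_assoc]
      gcongr
      rw [Finset.mul_sum, Finset.mul_sum]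
      refine Finset.sum_le_sum fun j _ => ?_
      rw [mul_pow]
      have h1 : (∑ j', pd d j' (pd d j R) (p + s ^ 2 • v) * v j') ^ 2 ≤
          d * (r ^ 2 * ∑ j', pd d j' (pd d j R) (p + s ^ 2 • v) ^ 2) := by
        refine (sq_sum_le_card_mul_sum_sq).trans ?_
        rw [Finset.card_univ, Fintype.card_fin]
        gcongr
        rw [Finset.mul_sum]
        refine Finset.sum_le_sum fun j' _ => ?_
        rw [mul_pow]
        nlinarith [hvr j', sq_nonneg (pd d j' (pd d j R) (p + s ^ 2 • v))]
      calc _ ≤ d * (r ^ 2 * ∑ j', pd d j' (pd d j R) (p + s ^ 2 • v) ^ 2) * r ^ 2 :=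
            mul_le_mul h1 (hvr j) (sq_nonneg _) (by positivity)
        _ = _ := by ring
    have hI : (∫ s in (0 : ℝ)..1, 2 * s ^ 3 * G s) ^ 2 ≤
        4 * d ^ 2 * r ^ 4 * ∫ s in (0 : ℝ)..1, s ^ 6 * W (p + s ^ 2 • v) := by
      refine (sq_integral_le_integral_sq (by fun_prop)).trans ?_
      rw [← intervalIntegral.integral_const_mul]
      refine intervalIntegral.integral_mono_on zero_le_one
        (Continuous.intervalIntegrable (by fun_prop) _ _)
        (Continuous.intervalIntegrable (by fun_prop) _ _) fun s _ => ?_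
      have h6 : 0 ≤ s ^ 6 := by positivity
      calc (2 * s ^ 3 * G s) ^ 2 = 4 * s ^ 6 * G s ^ 2 := by ring
        _ ≤ 4 * s ^ 6 * (d ^ 2 * r ^ 4 * W (p + s ^ 2 • v)) := by gcongr; exact hG2 s
        _ = _ := by ring
    nlinarith [sq_nonneg (L + ∫ s in (0 : ℝ)..1, 2 * s ^ 3 * G s)]
  have hprod : Integrable (Function.uncurry fun (s : ℝ) (y : Fin d → ℝ) =>
      s ^ 6 * W (p + s ^ 2 • (y - p)))
      ((volume.restrict (Set.uIoc (0 : ℝ) 1)).prod (volume.restrict Q)) := by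
    rw [Measure.prod_restrict]
    refine IntegrableOn.mono_set (t := Set.Icc (0 : ℝ) 1 ×ˢ K) ?_ ?_
    · refine ContinuousOn.integrableOn_compact (isCompact_Icc.prod isCompact_Icc) ?_
      unfold Function.uncurry
      fun_prop
    · refine Set.prod_mono ?_ hQK
      rw [Set.uIoc_of_le zero_le_one]
      exact Set.Ioc_subset_Icc_self
  have hswap := intervalIntegral_integral_swap hprod
  have hle : ∫ s in (0 : ℝ)..1, ∫ y in Q, s ^ 6 * W (p + s ^ 2 • (y - p)) ≤ ∫ y in Q, W y := by
    refine (le_abs_self _).trans ?_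
    have := intervalIntegral.norm_integral_le_of_norm_le_const (a := (0 : ℝ)) (b := 1)
      (f := fun s => ∫ y in Q, s ^ 6 * W (p + s ^ 2 • (y - p))) (C := ∫ y in Q, W y) ?_
    · simpa using this
    · intro s hs
      rw [Set.uIoc_of_le zero_le_one] at hs
      have h0 : 0 ≤ ∫ y in Q, W (p + s ^ 2 • (y - p)) := integral_nonneg fun y => hW0 _
      rw [integral_const_mul, Real.norm_of_nonneg (mul_nonneg (pow_nonneg hs.1.le _) h0)]
      refine le_trans ?_ (integral_comp_homothety_le hW0 hQ (hInt hWc) hstar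
        (pow_pos hs.1 2) (pow_le_one₀ hs.1.le hs.2))
      gcongr
      rw [← pow_mul]
      exact pow_le_pow_of_le_one hs.1.le hs.2 (by omega)
  have hInt2 : IntegrableOn
      (fun y => ∫ s in (0 : ℝ)..1, s ^ 6 * W (p + s ^ 2 • (y - p))) Q :=
    hInt (intervalIntegral.continuous_parametric_intervalIntegral_of_continuous'
      (f := fun y s => s ^ 6 * W (p + s ^ 2 • (y - p)))
      (by unfold Function.uncurry; fun_prop) 0 1)
  calc ∫ y in Q, (R p - R y) ^ 2
      ≤ ∫ y in Q, (2 * d * r ^ 2 * (∑ j, pd d j R y ^ 2) +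
        8 * d ^ 2 * r ^ 4 * ∫ s in (0 : ℝ)..1, s ^ 6 * W (p + s ^ 2 • (y - p))) :=
        setIntegral_mono_on (hInt (by fun_prop))
          ((hInt (by fun_prop)).add (hInt2.const_mul _)) hQ hpt
    _ = 2 * d * r ^ 2 * (∫ y in Q, ∑ j, pd d j R y ^ 2) + 8 * d ^ 2 * r ^ 4 *
          ∫ s in (0 : ℝ)..1, ∫ y in Q, s ^ 6 * W (p + s ^ 2 • (y - p)) := by
        rw [integral_add (hInt (by fun_prop)) (hInt2.const_mul _), integral_const_mul,
          integral_const_mul, hswap]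
    _ ≤ _ := by gcongr

/-- Bessel's inequality for a finite orthogonal family whose members share the squared norm
`N ≤ M`. -/
theorem sum_sq_integral_mul_le {α ι : Type*} [MeasurableSpace α] {μ : Measure α} [DecidableEq ι]
    (s : Finset ι) {u : ι → α → ℝ} {g : α → ℝ} {N M : ℝ} (hM : 0 < M) (hNM : N ≤ M)
    (hg : Integrable (fun x => g x ^ 2) μ) (hgu : ∀ k, Integrable (fun x => g x * u k x) μ)
    (huu : ∀ k l, Integrable (fun x => u k x * u l x) μ)
    (horth : ∀ k ∈ s, ∀ l ∈ s, ∫ x, u k x * u l x ∂μ = if k = l then N else 0) :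
    ∑ k ∈ s, (∫ x, g x * u k x ∂μ) ^ 2 ≤ M * ∫ x, g x ^ 2 ∂μ := by
  set b : ι → ℝ := fun k => ∫ x, g x * u k x ∂μ with hb
  set B := ∑ k ∈ s, b k ^ 2 with hB
  have h0 : 0 ≤ ∫ x, (g x - M⁻¹ * ∑ k ∈ s, b k * u k x) ^ 2 ∂μ :=
    integral_nonneg fun x => sq_nonneg _
  have hi1 : Integrable (fun x => ∑ k ∈ s, b k * (g x * u k x)) μ :=
    integrable_finsetSum _ fun k _ => (hgu k).const_mul _
  have hi2 : Integrable (fun x => ∑ k ∈ s, ∑ l ∈ s, b k * b l * (u k x * u l x)) μ :=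
    integrable_finsetSum _ fun k _ => integrable_finsetSum _ fun l _ => (huu k l).const_mul _
  have h1 : ∀ x, (g x - M⁻¹ * ∑ k ∈ s, b k * u k x) ^ 2 =
      g x ^ 2 - 2 * M⁻¹ * (∑ k ∈ s, b k * (g x * u k x)) +
        M⁻¹ ^ 2 * ∑ k ∈ s, ∑ l ∈ s, b k * b l * (u k x * u l x) := by
    intro x
    have e1 : ∑ k ∈ s, b k * (g x * u k x) = g x * ∑ k ∈ s, b k * u k x := by
      rw [Finset.mul_sum]; exact Finset.sum_congr rfl fun k _ => by ring
    have e2 : ∑ k ∈ s, ∑ l ∈ s, b k * b l * (u k x * u l x) = (∑ k ∈ s, b k * u k x) ^ 2 := by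
      rw [pow_two, Finset.sum_mul_sum]
      exact Finset.sum_congr rfl fun k _ => Finset.sum_congr rfl fun l _ => by ring
    rw [e1, e2]; ring
  have h2 : ∫ x, ∑ k ∈ s, b k * (g x * u k x) ∂μ = B := by
    rw [integral_finsetSum _ fun k _ => (hgu k).const_mul _]
    exact Finset.sum_congr rfl fun k _ => by rw [integral_const_mul, pow_two]
  have h3 : ∫ x, ∑ k ∈ s, ∑ l ∈ s, b k * b l * (u k x * u l x) ∂μ = N * B := by
    rw [integral_finsetSum _ fun k _ =>
      integrable_finsetSum _ fun l _ => (huu k l).const_mul _, hB, Finset.mul_sum]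
    refine Finset.sum_congr rfl fun k hk => ?_
    rw [integral_finsetSum _ fun l _ => (huu k l).const_mul _]
    have : ∀ l ∈ s, ∫ x, b k * b l * (u k x * u l x) ∂μ =
        if k = l then N * b k ^ 2 else 0 := fun l hl => by
      rw [integral_const_mul, horth k hk l hl]
      split_ifs with h
      · subst h; ring
      · ring
    rw [Finset.sum_congr rfl this, Finset.sum_ite_eq, if_pos hk]
  have hi3 : Integrable (fun x => g x ^ 2 - 2 * M⁻¹ * ∑ k ∈ s, b k * (g x * u k x)) μ :=
    hg.sub (hi1.const_mul _)
  rw [integral_congr_ae (ae_of_all _ h1), integral_add hi3 (hi2.const_mul _),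
    integral_sub hg (hi1.const_mul _), integral_const_mul,
    integral_const_mul, h2, h3] at h0
  have hB0 : 0 ≤ B := Finset.sum_nonneg fun k _ => sq_nonneg _
  have h4 : M * (M⁻¹ ^ 2 * (N * B)) ≤ B := by
    calc M * (M⁻¹ ^ 2 * (N * B)) = (N / M) * B := by field_simp
      _ ≤ 1 * B := by gcongr; rwa [div_le_one hM]
      _ = B := one_mul B
  have h5 : M * (2 * M⁻¹ * B) = 2 * B := by field_simp
  have h6 := mul_nonneg hM.le h0
  rw [mul_add, mul_sub, h5] at h6
  linarith

/-- Measurable and bounded on the unit cube. -/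
def CubeBdd (d : ℕ) (f : (Fin d → ℝ) → ℝ) : Prop :=
  Measurable f ∧ ∃ C, ∀ x ∈ cube d, |f x| ≤ C

namespace CubeBdd

variable {d : ℕ} {f g : (Fin d → ℝ) → ℝ}

theorem of_continuous (hf : Continuous f) : CubeBdd d f :=
  ⟨hf.measurable, (isCompact_cube d).exists_bound_of_continuousOn hf.continuousOn⟩

theorem mul (hf : CubeBdd d f) (hg : CubeBdd d g) : CubeBdd d fun x => f x * g x := by
  obtain ⟨hf, C, hC⟩ := hf
  obtain ⟨hg, D, hD⟩ := hg
  refine ⟨hf.mul hg, C * D, fun x hx => ?_⟩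
  rw [abs_mul]
  exact mul_le_mul (hC x hx) (hD x hx) (abs_nonneg _) ((abs_nonneg _).trans (hC x hx))

theorem sub (hf : CubeBdd d f) (hg : CubeBdd d g) : CubeBdd d fun x => f x - g x := by
  obtain ⟨hf, C, hC⟩ := hf
  obtain ⟨hg, D, hD⟩ := hg
  exact ⟨hf.sub hg, C + D, fun x hx => (abs_sub _ _).trans (add_le_add (hC x hx) (hD x hx))⟩

theorem pow (hf : CubeBdd d f) : CubeBdd d fun x => f x ^ 2 := by
  simpa only [pow_two] using hf.mul hf

theorem sum {ι : Type*} (s : Finset ι) {f : ι → (Fin d → ℝ) → ℝ} (hf : ∀ i, CubeBdd d (f i)) :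
    CubeBdd d fun x => ∑ i ∈ s, f i x := by
  choose hm C hC using hf
  exact ⟨Finset.measurable_fun_sum s fun i _ => hm i, ∑ i ∈ s, C i, fun x hx =>
    (Finset.abs_sum_le_sum_abs _ _).trans (Finset.sum_le_sum fun i _ => hC i x hx)⟩

theorem prod {ι : Type*} (s : Finset ι) {f : ι → (Fin d → ℝ) → ℝ} (hf : ∀ i, CubeBdd d (f i)) :
    CubeBdd d fun x => ∏ i ∈ s, f i x := by
  choose hm C hC using hf
  refine ⟨Finset.measurable_fun_prod s fun i _ => hm i, ∏ i ∈ s, C i, fun x hx => ?_⟩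
  rw [Finset.abs_prod]
  exact Finset.prod_le_prod (fun i _ => abs_nonneg _) fun i _ => hC i x hx

theorem integrable (hf : CubeBdd d f) : IntegrableOn f (cube d) := by
  obtain ⟨hf, C, hC⟩ := hf
  have : volume (cube d) < ⊤ := (isCompact_cube d).measure_lt_top
  exact Measure.integrableOn_of_bounded this.ne hf.aestronglyMeasurable
    ((ae_restrict_iff' (measurableSet_cube d)).2 (ae_of_all _ hC))

end CubeBdd

theorem integral_cube_prod {d : ℕ} (f : Fin d → ℝ → ℝ) :
    ∫ x in cube d, ∏ j, f j (x j) = ∏ j, ∫ t in Set.Icc (0 : ℝ) 1, f j t := by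
  rw [cube_eq_pi, volume_pi, Measure.restrict_pi_pi]
  exact integral_fintype_prod_eq_prod f

theorem integral_cos_int_mul_pi (m : ℤ) :
    ∫ t in (0 : ℝ)..1, Real.cos (m * Real.pi * t) = if m = 0 then 1 else 0 := by
  split_ifs with h
  · simp [h]
  · have : (m : ℝ) * Real.pi ≠ 0 := mul_ne_zero (by exact_mod_cast h) Real.pi_ne_zero
    rw [intervalIntegral.integral_comp_mul_left _ this]
    simp

/-- The `L²(0,1)`-normalised sine of frequency `k + 1`. -/
noncomputable def sineMode (k : ℕ) (t : ℝ) : ℝ := √2 * Real.sin (((k : ℝ) + 1) * Real.pi * t)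

theorem integral_sineMode_mul (k l : ℕ) :
    ∫ t in Set.Icc (0 : ℝ) 1, sineMode k t * sineMode l t = if k = l then 1 else 0 := by
  rw [integral_Icc_eq_integral_Ioc, ← intervalIntegral.integral_of_le zero_le_one]
  have h : ∀ t, sineMode k t * sineMode l t = Real.cos (((k - l : ℤ) : ℝ) * Real.pi * t) -
      Real.cos (((k + l + 2 : ℤ) : ℝ) * Real.pi * t) := by
    intro t
    have e : sineMode k t * sineMode l t = √2 ^ 2 *
        (Real.sin (((k : ℝ) + 1) * Real.pi * t) * Real.sin (((l : ℝ) + 1) * Real.pi * t)) := by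
      unfold sineMode; ring
    have e1 : ((k - l : ℤ) : ℝ) * Real.pi * t =
        ((k : ℝ) + 1) * Real.pi * t - ((l : ℝ) + 1) * Real.pi * t := by push_cast; ring
    have e2 : ((k + l + 2 : ℤ) : ℝ) * Real.pi * t =
        ((k : ℝ) + 1) * Real.pi * t + ((l : ℝ) + 1) * Real.pi * t := by push_cast; ring
    rw [e, e1, e2, Real.cos_sub, Real.cos_add, Real.sq_sqrt zero_le_two]
    ring
  simp only [h]
  rw [intervalIntegral.integral_sub, integral_cos_int_mul_pi, integral_cos_int_mul_pi,
    if_neg (by omega : ¬ (k + l + 2 : ℤ) = 0), sub_zero]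
  · congr 1
    rw [sub_eq_zero, Nat.cast_inj]
  all_goals exact Continuous.intervalIntegrable (by fun_prop) _ _

theorem eigenFun_eq_prod (d : ℕ) (k : Fin d → ℕ) (x : Fin d → ℝ) :
    eigenFun d k x = ∏ j, sineMode (k j) (x j) := by
  unfold eigenFun sineMode
  rw [Finset.prod_mul_distrib, Finset.prod_const, Finset.card_univ, Fintype.card_fin,
    Real.sqrt_eq_rpow, ← Real.rpow_natCast, ← Real.rpow_mul zero_le_two]
  congr 2
  ring

theorem continuous_eigenFun (d : ℕ) (k : Fin d → ℕ) : Continuous (eigenFun d k) := by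
  unfold eigenFun; fun_prop

theorem integral_prod_mul_eigenFun (d : ℕ) (w : Fin d → ℝ → ℝ) (k l : Fin d → ℕ) :
    ∫ x in cube d, (∏ j, w j (x j)) * (eigenFun d k x * eigenFun d l x) =
      ∏ j, ∫ t in Set.Icc (0 : ℝ) 1, w j t * (sineMode (k j) t * sineMode (l j) t) := by
  rw [← integral_cube_prod]
  simp only [eigenFun_eq_prod, Finset.prod_mul_distrib]

theorem integral_eigenFun_mul (d : ℕ) (k l : Fin d → ℕ) :
    ∫ x in cube d, eigenFun d k x * eigenFun d l x = if k = l then 1 else 0 := by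
  have h := integral_prod_mul_eigenFun d (fun _ _ => 1) k l
  simp only [Finset.prod_const_one, one_mul, integral_sineMode_mul] at h
  rw [h]
  split_ifs with hkl
  · simp [hkl]
  · obtain ⟨j, hj⟩ := Function.ne_iff.1 hkl
    exact Finset.prod_eq_zero (Finset.mem_univ j) (if_neg hj)

theorem sum_sq_integral_mul_eigenFun_le {d : ℕ} {g : (Fin d → ℝ) → ℝ} (hg : CubeBdd d g)
    (s : Finset (Fin d → ℕ)) :
    ∑ k ∈ s, (∫ x in cube d, g x * eigenFun d k x) ^ 2 ≤ ∫ x in cube d, g x ^ 2 := by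
  have hφ : ∀ k, CubeBdd d (eigenFun d k) := fun k => .of_continuous (continuous_eigenFun d k)
  simpa using sum_sq_integral_mul_le s one_pos le_rfl hg.pow.integrable
    (fun k => (hg.mul (hφ k)).integrable) (fun k l => ((hφ k).mul (hφ l)).integrable)
    (fun k _ l _ => integral_eigenFun_mul d k l)

/-- Indicator of the half-open cell of length `mesh n` centred at `(i + 1) * mesh n`. -/
noncomputable def cellInd (n i : ℕ) : ℝ → ℝ :=
  (Set.Ico (((i : ℝ) + 1 / 2) * mesh n) (((i : ℝ) + 3 / 2) * mesh n)).indicator 1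

/-- Indicator of the part of the unit interval not covered by the cells of `cellInd`. -/
noncomputable def edgeInd (n : ℕ) (t : ℝ) : ℝ := 1 - ∑ i : Fin n, cellInd n i t

theorem measurable_cellInd (n i : ℕ) : Measurable (cellInd n i) :=
  measurable_one.indicator measurableSet_Ico

theorem measurable_edgeInd (n : ℕ) : Measurable (edgeInd n) :=
  measurable_const.sub (Finset.measurable_fun_sum _ fun i _ => measurable_cellInd n i)

theorem cellInd_eq (n i : ℕ) (t : ℝ) : cellInd n i t =
    if ((i : ℝ) + 1 / 2) * mesh n ≤ t ∧ t < ((i : ℝ) + 3 / 2) * mesh n then 1 else 0 := by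
  simp only [cellInd, Set.indicator_apply, Set.mem_Ico, Pi.one_apply]

theorem sum_cellInd (n m : ℕ) (t : ℝ) : ∑ i : Fin m, cellInd n i t =
    if mesh n / 2 ≤ t ∧ t < ((m : ℝ) + 1 / 2) * mesh n then 1 else 0 := by
  have hh := mesh_pos n
  induction m with
  | zero =>
    have : ¬(mesh n / 2 ≤ t ∧ t < (((0 : ℕ) : ℝ) + 1 / 2) * mesh n) := by
      rintro ⟨h1, h2⟩; push_cast at h2; linarith
    rw [if_neg this]; simp
  | succ m ih =>
    rw [Fin.sum_univ_castSucc]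
    simp only [Fin.val_castSucc, Fin.val_last]
    rw [ih, cellInd_eq]
    push_cast
    have hm : (0 : ℝ) ≤ m * mesh n := by positivity
    split_ifs <;> grind

theorem edgeInd_eq (n : ℕ) (t : ℝ) :
    edgeInd n t = if mesh n / 2 ≤ t ∧ t < 1 - mesh n / 2 then 0 else 1 := by
  have h : ((n : ℝ) + 1 / 2) * mesh n = 1 - mesh n / 2 := by linear_combination mesh_mul n
  rw [edgeInd, sum_cellInd, h]
  split_ifs <;> norm_num

theorem edgeInd_mem (n : ℕ) (t : ℝ) : 0 ≤ edgeInd n t ∧ edgeInd n t ≤ 1 := by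
  rw [edgeInd_eq]; split_ifs <;> norm_num

theorem integral_cellInd_mul {n : ℕ} (i : Fin n) (f : ℝ → ℝ) :
    ∫ t in Set.Icc (0 : ℝ) 1, cellInd n i t * f t =
      ∫ t in (((i : ℕ) : ℝ) + 1 / 2) * mesh n..(((i : ℕ) : ℝ) + 3 / 2) * mesh n, f t := by
  have hh := mesh_pos n
  have hm := mesh_mul n
  have hi : ((i : ℕ) : ℝ) + 1 ≤ n := by exact_mod_cast i.2
  set S := Set.Ico ((((i : ℕ) : ℝ) + 1 / 2) * mesh n) ((((i : ℕ) : ℝ) + 3 / 2) * mesh n) with hS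
  have hsub : S ⊆ Set.Icc 0 1 := by
    rintro t ⟨h1, h2⟩
    constructor
    · exact le_trans (by positivity) h1
    · nlinarith
  have h1 : (fun t => cellInd n i t * f t) = S.indicator f := by
    funext t
    simp only [cellInd, Set.indicator_apply, ← hS, Pi.one_apply]
    split_ifs <;> simp
  rw [h1, setIntegral_indicator measurableSet_Ico, Set.inter_eq_self_of_subset_right hsub,
    intervalIntegral.integral_of_le (by gcongr; norm_num), integral_Ico_eq_integral_Ioo,
    integral_Ioc_eq_integral_Ioo]

theorem integral_cellInd_mul_sineMode {n : ℕ} (i : Fin n) (k : ℕ) :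
    ∫ t in Set.Icc (0 : ℝ) 1, cellInd n i t * sineMode k t =
      mesh n * Real.sinc (((k : ℝ) + 1) * Real.pi * mesh n / 2) *
        sineMode k ((((i : ℕ) : ℝ) + 1) * mesh n) := by
  rw [integral_cellInd_mul]
  have hh := mesh_pos n
  have hk : ((k : ℝ) + 1) * Real.pi ≠ 0 := by positivity
  unfold sineMode
  rw [intervalIntegral.integral_const_mul, intervalIntegral.integral_comp_mul_left _ hk,
    integral_sin, Real.sinc_of_ne_zero (by positivity)]
  set θ := ((k : ℝ) + 1) * Real.pi * mesh n / 2 with hθ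
  set x := ((k : ℝ) + 1) * Real.pi * ((((i : ℕ) : ℝ) + 1) * mesh n) with hx
  have e1 : ((k : ℝ) + 1) * Real.pi * ((((i : ℕ) : ℝ) + 1 / 2) * mesh n) = x - θ := by
    rw [hx, hθ]; ring
  have e2 : ((k : ℝ) + 1) * Real.pi * ((((i : ℕ) : ℝ) + 3 / 2) * mesh n) = x + θ := by
    rw [hx, hθ]; ring
  rw [e1, e2, Real.cos_sub, Real.cos_add, smul_eq_mul, hθ]
  field_simp
  ring

theorem integral_edgeInd (n : ℕ) : ∫ t in Set.Icc (0 : ℝ) 1, edgeInd n t = mesh n := by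
  have h1 : ∀ i : Fin n, ∫ t in Set.Icc (0 : ℝ) 1, cellInd n i t = mesh n := fun i => by
    have := integral_cellInd_mul i fun _ => 1
    simp only [mul_one, intervalIntegral.integral_const, smul_eq_mul] at this
    rw [this]; ring
  have hi : ∀ i : Fin n, IntegrableOn (cellInd n i) (Set.Icc (0 : ℝ) 1) := fun i =>
    (integrable_const (1 : ℝ)).indicator measurableSet_Ico
  unfold edgeInd
  rw [integral_sub (integrable_const _) (integrable_finsetSum _ fun i _ => hi i),
    integral_finsetSum _ fun i _ => hi i, Finset.sum_congr rfl fun i _ => h1 i]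
  simp
  linear_combination -mesh_mul n

theorem abs_sin_le_of_edge {n : ℕ} (k : ℕ) {t : ℝ} (ht : t ∈ Set.Icc (0 : ℝ) 1)
    (he : ¬(mesh n / 2 ≤ t ∧ t < 1 - mesh n / 2)) :
    |Real.sin (((k : ℝ) + 1) * Real.pi * t)| ≤ ((k : ℝ) + 1) * Real.pi * (mesh n / 2) := by
  have hh := mesh_pos n
  have hk : 0 ≤ ((k : ℝ) + 1) * Real.pi := by positivity
  have key : ∀ s : ℝ, 0 ≤ s → s ≤ mesh n / 2 →
      |Real.sin (((k : ℝ) + 1) * Real.pi * s)| ≤ ((k : ℝ) + 1) * Real.pi * (mesh n / 2) := by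
    intro s h0 h1
    refine (Real.abs_sin_le_abs).trans ?_
    rw [abs_of_nonneg (mul_nonneg hk h0)]
    gcongr
  rcases lt_or_ge t (mesh n / 2) with h | h
  · exact key t ht.1 h.le
  · have h2 : 1 - mesh n / 2 ≤ t := not_lt.1 fun h' => he ⟨h, h'⟩
    have h3 := key (1 - t) (by linarith [ht.2]) (by linarith)
    have h4 : ((k : ℝ) + 1) * Real.pi * (1 - t) =
        ((k + 1 : ℕ) : ℝ) * Real.pi - ((k : ℝ) + 1) * Real.pi * t := by push_cast; ring
    rw [h4, Real.sin_nat_mul_pi_sub, abs_neg, abs_mul, abs_pow, abs_neg, abs_one, one_pow,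
      one_mul] at h3
    exact h3

theorem integral_edgeInd_sq_mul_sineMode_sq_le (n k : ℕ) :
    ∫ t in Set.Icc (0 : ℝ) 1, edgeInd n t ^ 2 * (sineMode k t * sineMode k t) ≤
      ((k : ℝ) + 1) ^ 2 * Real.pi ^ 2 * mesh n ^ 3 := by
  have hh := mesh_pos n
  have hei : IntegrableOn (edgeInd n) (Set.Icc (0 : ℝ) 1) :=
    Measure.integrableOn_of_bounded (M := 1) (by simp) (measurable_edgeInd n).aestronglyMeasurable
      (ae_of_all _ fun t => by
        rw [Real.norm_of_nonneg (edgeInd_mem n t).1]; exact (edgeInd_mem n t).2)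
  calc _ ≤ ∫ t in Set.Icc (0 : ℝ) 1,
        ((k : ℝ) + 1) ^ 2 * Real.pi ^ 2 * mesh n ^ 2 * edgeInd n t := by
        refine integral_mono_of_nonneg (ae_of_all _ fun t =>
          mul_nonneg (sq_nonneg _) (mul_self_nonneg _)) (hei.const_mul _) ?_
        refine (ae_restrict_iff' measurableSet_Icc).2 (ae_of_all _ fun t ht => ?_)
        dsimp only
        rw [edgeInd_eq]
        split_ifs with he
        · simp
        · have h1 := abs_sin_le_of_edge k ht he
          have h2 := pow_le_pow_left₀ (abs_nonneg _) h1 2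
          rw [sq_abs] at h2
          have h3 : sineMode k t * sineMode k t =
              2 * Real.sin (((k : ℝ) + 1) * Real.pi * t) ^ 2 := by
            unfold sineMode
            linear_combination Real.sin (((k : ℝ) + 1) * Real.pi * t) ^ 2 *
              Real.sq_sqrt (zero_le_two (α := ℝ))
          have h4 : 0 ≤ (((k : ℝ) + 1) * Real.pi * mesh n) ^ 2 := sq_nonneg _
          rw [h3]
          nlinarith
    _ = _ := by rw [integral_const_mul, integral_edgeInd]; ring

theorem sum_sq_integral_edgeInd_mul_eigenFun_le {d n : ℕ} {g : (Fin d → ℝ) → ℝ}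
    (hg : CubeBdd d g) (j : Fin d) (κ : ℕ) (s : Finset (Fin d → ℕ)) (hs : ∀ k ∈ s, k j = κ) :
    ∑ k ∈ s, (∫ x in cube d, g x * (edgeInd n (x j) * eigenFun d k x)) ^ 2 ≤
      ((κ : ℝ) + 1) ^ 2 * Real.pi ^ 2 * mesh n ^ 3 * ∫ x in cube d, g x ^ 2 := by
  have hh := mesh_pos n
  have he : CubeBdd d fun x => edgeInd n (x j) :=
    ⟨(measurable_edgeInd n).comp (measurable_pi_apply j), 1, fun x _ => by
      rw [abs_of_nonneg (edgeInd_mem n _).1]; exact (edgeInd_mem n _).2⟩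
  have hu : ∀ k, CubeBdd d fun x => edgeInd n (x j) * eigenFun d k x := fun k =>
    he.mul (.of_continuous (continuous_eigenFun d k))
  refine sum_sq_integral_mul_le s (by positivity)
    (integral_edgeInd_sq_mul_sineMode_sq_le n κ) hg.pow.integrable
    (fun k => (hg.mul (hu k)).integrable) (fun k l => ((hu k).mul (hu l)).integrable) ?_
  intro k hk l hl
  have h1 : ∀ x : Fin d → ℝ, edgeInd n (x j) * eigenFun d k x * (edgeInd n (x j) * eigenFun d l x) =
      (∏ i, (fun i t => if i = j then edgeInd n t ^ 2 else 1 : Fin d → ℝ → ℝ) i (x i)) *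
        (eigenFun d k x * eigenFun d l x) := by
    intro x
    rw [Finset.prod_ite_eq' Finset.univ j, if_pos (Finset.mem_univ j)]
    ring
  simp only [h1]
  refine (integral_prod_mul_eigenFun d
    (fun i t => if i = j then edgeInd n t ^ 2 else 1) k l).trans ?_
  split_ifs with hkl
  · subst hkl
    rw [Finset.prod_eq_single j]
    · simp [hs k hk]
    · intro i _ hij
      simp [hij, integral_sineMode_mul]
    · simp
  · obtain ⟨i, hi⟩ := Function.ne_iff.1 hkl
    refine Finset.prod_eq_zero (Finset.mem_univ i) ?_
    have hij : i ≠ j := fun h => hi (by rw [h, hs k hk, hs l hl])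
    simp [hij, integral_sineMode_mul, hi]

/-- The half-open box of side `mesh n` centred at `gridPt d n i`. -/
def cellBox (d n : ℕ) (i : Fin d → Fin n) : Set (Fin d → ℝ) :=
  Set.univ.pi fun j => Set.Ico ((((i j : ℕ) : ℝ) + 1 / 2) * mesh n)
    ((((i j : ℕ) : ℝ) + 3 / 2) * mesh n)

/-- Indicator function of `cellBox`. -/
noncomputable def boxInd (d n : ℕ) (i : Fin d → Fin n) (x : Fin d → ℝ) : ℝ :=
  ∏ j, cellInd n (i j) (x j)

theorem boxInd_eq_indicator {d n : ℕ} (i : Fin d → Fin n) (f : (Fin d → ℝ) → ℝ) (x : Fin d → ℝ) :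
    boxInd d n i x * f x = (cellBox d n i).indicator f x := by
  by_cases hx : x ∈ cellBox d n i
  · rw [Set.indicator_of_mem hx, boxInd, Finset.prod_eq_one, one_mul]
    intro j _
    exact Set.indicator_of_mem (hx j (Set.mem_univ j)) _
  · rw [Set.indicator_of_notMem hx]
    simp only [cellBox, Set.mem_univ_pi, not_forall] at hx
    obtain ⟨j, hj⟩ := hx
    rw [boxInd, Finset.prod_eq_zero (Finset.mem_univ j), zero_mul]
    exact Set.indicator_of_notMem hj _

theorem boxInd_nonneg {d n : ℕ} (i : Fin d → Fin n) (x : Fin d → ℝ) : 0 ≤ boxInd d n i x :=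
  Finset.prod_nonneg fun _ _ => Set.indicator_nonneg (fun _ _ => zero_le_one) _

theorem sum_boxInd (d n : ℕ) (x : Fin d → ℝ) :
    ∑ i : Fin d → Fin n, boxInd d n i x = ∏ j, (1 - edgeInd n (x j)) := by
  simp only [boxInd, edgeInd, sub_sub_cancel]
  rw [Finset.prod_univ_sum, Fintype.piFinset_univ]

theorem prod_one_sub_edgeInd_mem {d : ℕ} (n : ℕ) (s : Finset (Fin d)) (x : Fin d → ℝ) :
    0 ≤ ∏ j ∈ s, (1 - edgeInd n (x j)) ∧ ∏ j ∈ s, (1 - edgeInd n (x j)) ≤ 1 :=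
  ⟨Finset.prod_nonneg fun j _ => sub_nonneg.2 (edgeInd_mem n (x j)).2,
    Finset.prod_le_one (fun j _ => sub_nonneg.2 (edgeInd_mem n (x j)).2)
      fun j _ => sub_le_self _ (edgeInd_mem n (x j)).1⟩

theorem cubeBdd_edgeInd {d : ℕ} (n : ℕ) (j : Fin d) : CubeBdd d fun x => edgeInd n (x j) :=
  ⟨(measurable_edgeInd n).comp (measurable_pi_apply j), 1, fun x _ => by
    rw [abs_of_nonneg (edgeInd_mem n _).1]; exact (edgeInd_mem n _).2⟩

theorem cubeBdd_boxInd {d n : ℕ} (i : Fin d → Fin n) : CubeBdd d (boxInd d n i) := by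
  refine CubeBdd.prod Finset.univ fun j =>
    ⟨(measurable_cellInd n (i j)).comp (measurable_pi_apply j), 1, fun x _ => ?_⟩
  change |cellInd n (i j) (x j)| ≤ 1
  rw [cellInd_eq]
  split_ifs <;> norm_num

theorem cellBox_subset_cube {d n : ℕ} (i : Fin d → Fin n) : cellBox d n i ⊆ cube d := by
  intro x hx
  have hh := mesh_pos n
  have hm := mesh_mul n
  refine mem_cube_iff.2 fun j => ?_
  have h1 := hx j (Set.mem_univ j)
  rw [Set.mem_Ico] at h1
  have h2 : ((i j : ℕ) : ℝ) + 1 ≤ n := by exact_mod_cast (i j).2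
  constructor
  · exact le_trans (by positivity) h1.1
  · nlinarith

theorem measurableSet_cellBox {d n : ℕ} (i : Fin d → Fin n) : MeasurableSet (cellBox d n i) :=
  MeasurableSet.univ_pi fun _ => measurableSet_Ico

theorem setIntegral_boxInd_mul {d n : ℕ} (i : Fin d → Fin n) (f : (Fin d → ℝ) → ℝ) :
    ∫ x in cube d, boxInd d n i x * f x = ∫ x in cellBox d n i, f x := by
  simp only [boxInd_eq_indicator]
  rw [setIntegral_indicator (measurableSet_cellBox i),
    Set.inter_eq_right.2 (cellBox_subset_cube i)]

theorem sum_setIntegral_cellBox_le {d : ℕ} (n : ℕ) {G : (Fin d → ℝ) → ℝ} (hG : Continuous G)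
    (hG0 : ∀ x, 0 ≤ G x) :
    ∑ i : Fin d → Fin n, ∫ x in cellBox d n i, G x ≤ ∫ x in cube d, G x := by
  have hG' := CubeBdd.of_continuous hG
  simp only [← setIntegral_boxInd_mul]
  rw [← integral_finsetSum _ fun i _ => ((cubeBdd_boxInd i).mul hG').integrable]
  refine setIntegral_mono_on
    (CubeBdd.sum Finset.univ fun i => (cubeBdd_boxInd i).mul hG').integrable
    hG'.integrable (measurableSet_cube d) fun x _ => ?_
  rw [← Finset.sum_mul, sum_boxInd]
  exact mul_le_of_le_one_left (hG0 x) (prod_one_sub_edgeInd_mem n _ x).2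

/-- The piecewise constant interpolant of `R` on the cells `cellBox`. -/
noncomputable def cellInterp (d n : ℕ) (R : (Fin d → ℝ) → ℝ) (x : Fin d → ℝ) : ℝ :=
  ∑ i : Fin d → Fin n, boxInd d n i x * R (gridPt d n i)

/-- The interpolation error of `cellInterp`, restricted to the union of the cells. -/
noncomputable def interpErr (d n : ℕ) (R : (Fin d → ℝ) → ℝ) (x : Fin d → ℝ) : ℝ :=
  ∑ i : Fin d → Fin n, boxInd d n i x * (R (gridPt d n i) - R x)

theorem cellInterp_eq (d n : ℕ) (R : (Fin d → ℝ) → ℝ) (x : Fin d → ℝ) :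
    cellInterp d n R x = interpErr d n R x + R x * ∏ j, (1 - edgeInd n (x j)) := by
  simp only [cellInterp, interpErr, mul_sub, Finset.sum_sub_distrib, ← Finset.sum_mul, sum_boxInd]
  ring

theorem cubeBdd_interpErr {d : ℕ} (n : ℕ) {R : (Fin d → ℝ) → ℝ} (hR : Continuous R) :
    CubeBdd d (interpErr d n R) :=
  .sum _ fun i => (cubeBdd_boxInd i).mul (.of_continuous (continuous_const.sub hR))

theorem cubeBdd_cellInterp (d n : ℕ) (R : (Fin d → ℝ) → ℝ) : CubeBdd d (cellInterp d n R) :=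
  .sum _ fun i => (cubeBdd_boxInd i).mul (.of_continuous continuous_const)

theorem interpErr_sq_le (d n : ℕ) (R : (Fin d → ℝ) → ℝ) (x : Fin d → ℝ) :
    interpErr d n R x ^ 2 ≤
      ∑ i : Fin d → Fin n, boxInd d n i x * (R (gridPt d n i) - R x) ^ 2 := by
  have h0 : 0 ≤ ∑ i : Fin d → Fin n, boxInd d n i x * (R (gridPt d n i) - R x) ^ 2 :=
    Finset.sum_nonneg fun i _ => mul_nonneg (boxInd_nonneg i x) (sq_nonneg _)
  refine (Finset.sum_sq_le_sum_mul_sum_of_sq_le_mul Finset.univ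
    (f := fun i => boxInd d n i x)
    (g := fun i => boxInd d n i x * (R (gridPt d n i) - R x) ^ 2)
    (fun i _ => boxInd_nonneg i x)
    (fun i _ => mul_nonneg (boxInd_nonneg i x) (sq_nonneg _)) fun i _ =>
      le_of_eq (by ring)).trans ?_
  rw [sum_boxInd]
  exact mul_le_of_le_one_left h0 (prod_one_sub_edgeInd_mem n _ x).2

theorem H2sq_nonneg {d : ℕ} (R : (Fin d → ℝ) → ℝ) : 0 ≤ H2sq d R := by
  refine add_nonneg (add_nonneg (integral_nonneg fun x => sq_nonneg _)
    (Finset.sum_nonneg fun j _ => integral_nonneg fun x => sq_nonneg _))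
    (Finset.sum_nonneg fun j _ => Finset.sum_nonneg fun j' _ => ?_)
  split_ifs
  · exact integral_nonneg fun x => sq_nonneg _
  · exact le_rfl

theorem integral_sq_le_H2sq {d : ℕ} (R : (Fin d → ℝ) → ℝ) :
    ∫ x in cube d, R x ^ 2 ≤ H2sq d R := by
  have h1 : 0 ≤ ∑ j : Fin d, ∫ x in cube d, pd d j R x ^ 2 :=
    Finset.sum_nonneg fun j _ => integral_nonneg fun x => sq_nonneg _
  have h2 : 0 ≤ ∑ j : Fin d, ∑ j' : Fin d,
      if j ≤ j' then ∫ x in cube d, pd d j (pd d j' R) x ^ 2 else 0 := by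
    refine Finset.sum_nonneg fun j _ => Finset.sum_nonneg fun j' _ => ?_
    split_ifs
    · exact integral_nonneg fun x => sq_nonneg _
    · exact le_rfl
  unfold H2sq
  linarith

theorem integral_interpErr_sq_le {d : ℕ} (hd : d ≤ 3) (n : ℕ) {R : (Fin d → ℝ) → ℝ}
    (hR : ContDiff ℝ 2 R) :
    ∫ x in cube d, interpErr d n R x ^ 2 ≤ 9 * mesh n ^ 2 * H2sq d R := by
  have hh := mesh_pos n
  have hh1 := mesh_le_one n
  have hc := hR.continuous
  have hsq : ∀ i : Fin d → Fin n, CubeBdd d fun x =>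
      boxInd d n i x * (R (gridPt d n i) - R x) ^ 2 := fun i =>
    (cubeBdd_boxInd i).mul (.of_continuous (by fun_prop))
  have hp1 : Continuous fun y => ∑ j, pd d j R y ^ 2 :=
    continuous_finsetSum _ fun j _ => (continuous_pd hR j).pow 2
  have hp2 : Continuous fun y => ∑ j, ∑ j', pd d j' (pd d j R) y ^ 2 :=
    continuous_finsetSum _ fun j _ => continuous_finsetSum _ fun j' _ =>
      (continuous_pd_pd hR j' j).pow 2
  set A := ∫ y in cube d, ∑ j, pd d j R y ^ 2 with hA
  set B := ∫ y in cube d, ∑ j, ∑ j', pd d j' (pd d j R) y ^ 2 with hB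
  have hA0 : 0 ≤ A := integral_nonneg fun y => Finset.sum_nonneg fun j _ => sq_nonneg _
  have hB0 : 0 ≤ B := integral_nonneg fun y =>
    Finset.sum_nonneg fun j _ => Finset.sum_nonneg fun j' _ => sq_nonneg _
  have hAB : A + B ≤ 2 * H2sq d R := by
    have h1 := sum_pd_pd_le_H2sq hR
    have h2 : A = ∑ j, ∫ x in cube d, pd d j R x ^ 2 :=
      integral_finsetSum _ fun j _ => integrableOn_cube ((continuous_pd hR j).pow 2)
    have h3 : B = ∑ j, ∑ j', ∫ x in cube d, pd d j (pd d j' R) x ^ 2 := by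
      refine (integral_finsetSum _ fun j _ => integrableOn_cube
        (continuous_finsetSum _ fun j' _ => (continuous_pd_pd hR j' j).pow 2)).trans ?_
      rw [Finset.sum_comm]
      refine Finset.sum_congr rfl fun j _ => ?_
      exact integral_finsetSum _ fun j' _ => integrableOn_cube ((continuous_pd_pd hR j' j).pow 2)
    have h4 : 0 ≤ ∫ x in cube d, R x ^ 2 := integral_nonneg fun x => sq_nonneg _
    linarith
  have hcell : ∀ i : Fin d → Fin n, ∫ x in cellBox d n i, (R (gridPt d n i) - R x) ^ 2 ≤
      2 * d * (mesh n / 2) ^ 2 * (∫ y in cellBox d n i, ∑ j, pd d j R y ^ 2) +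
        8 * d ^ 2 * (mesh n / 2) ^ 4 *
          ∫ y in cellBox d n i, ∑ j, ∑ j', pd d j' (pd d j R) y ^ 2 := by
    intro i
    refine integral_sub_sq_le hd hR (measurableSet_cellBox i) ?_ ?_
    · refine Convex.starConvex (convex_pi fun j _ => convex_Ico _ _) fun j _ => ?_
      simp only [gridPt, Set.mem_Ico]
      constructor <;> nlinarith
    · intro y hy j
      have h1 := hy j (Set.mem_univ j)
      rw [Set.mem_Ico] at h1
      simp only [gridPt]
      rw [abs_le]
      constructor <;> nlinarith
  have hd' : (d : ℝ) ≤ 3 := by exact_mod_cast hd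
  have hd0 : (0 : ℝ) ≤ d := Nat.cast_nonneg d
  have hS1 := sum_setIntegral_cellBox_le n hp1 fun y => Finset.sum_nonneg fun j _ => sq_nonneg _
  have hS2 := sum_setIntegral_cellBox_le n hp2 fun y =>
    Finset.sum_nonneg fun j _ => Finset.sum_nonneg fun j' _ => sq_nonneg _
  calc ∫ x in cube d, interpErr d n R x ^ 2
      ≤ ∫ x in cube d, ∑ i : Fin d → Fin n, boxInd d n i x * (R (gridPt d n i) - R x) ^ 2 :=
        setIntegral_mono_on (cubeBdd_interpErr n hc).pow.integrable
          (CubeBdd.sum _ hsq).integrable (measurableSet_cube d) fun x _ => interpErr_sq_le d n R x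
    _ = ∑ i : Fin d → Fin n, ∫ x in cellBox d n i, (R (gridPt d n i) - R x) ^ 2 := by
        rw [integral_finsetSum _ fun i _ => (hsq i).integrable]
        exact Finset.sum_congr rfl fun i _ =>
          setIntegral_boxInd_mul i fun x => (R (gridPt d n i) - R x) ^ 2
    _ ≤ 2 * d * (mesh n / 2) ^ 2 * A + 8 * d ^ 2 * (mesh n / 2) ^ 4 * B := by
        refine (Finset.sum_le_sum fun i _ => hcell i).trans ?_
        rw [Finset.sum_add_distrib, ← Finset.mul_sum, ← Finset.mul_sum]
        gcongr
    _ ≤ 2 * 3 * (mesh n / 2) ^ 2 * A + 8 * 3 ^ 2 * (mesh n / 2) ^ 4 * B := by gcongr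
    _ ≤ (9 / 2) * mesh n ^ 2 * (A + B) := by
        have h4 : mesh n ^ 4 ≤ mesh n ^ 2 := pow_le_pow_of_le_one hh.le hh1 (by norm_num)
        nlinarith [mul_nonneg (sq_nonneg (mesh n)) hA0, mul_le_mul_of_nonneg_right h4 hB0]
    _ ≤ (9 / 2) * mesh n ^ 2 * (2 * H2sq d R) := by gcongr
    _ = _ := by ring

theorem integral_cellInterp_sq_le {d : ℕ} (hd : d ≤ 3) (n : ℕ) {R : (Fin d → ℝ) → ℝ}
    (hR : ContDiff ℝ 2 R) :
    ∫ x in cube d, cellInterp d n R x ^ 2 ≤ 20 * H2sq d R := by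
  have hc := hR.continuous
  have h1 := integral_interpErr_sq_le hd n hR
  have h2 := integral_sq_le_H2sq R
  have h3 : mesh n ^ 2 ≤ 1 := pow_le_one₀ (mesh_pos n).le (mesh_le_one n)
  have h4 := H2sq_nonneg R
  have hI : IntegrableOn (fun x => R x ^ 2) (cube d) := integrableOn_cube (hc.pow 2)
  calc ∫ x in cube d, cellInterp d n R x ^ 2
      ≤ ∫ x in cube d, (2 * interpErr d n R x ^ 2 + 2 * R x ^ 2) := by
        refine setIntegral_mono_on (cubeBdd_cellInterp d n R).pow.integrable
          (((cubeBdd_interpErr n hc).pow.integrable.const_mul 2).add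
            (hI.const_mul 2)) (measurableSet_cube d) fun x _ => ?_
        rw [cellInterp_eq]
        obtain ⟨hp0, hp1⟩ := prod_one_sub_edgeInd_mem n Finset.univ x
        set p := ∏ j, (1 - edgeInd n (x j))
        have hp : (R x * p) ^ 2 ≤ R x ^ 2 := by
          rw [mul_pow]; exact mul_le_of_le_one_right (sq_nonneg _) (pow_le_one₀ hp0 hp1)
        nlinarith [sq_nonneg (interpErr d n R x - R x * p)]
    _ = 2 * (∫ x in cube d, interpErr d n R x ^ 2) + 2 * ∫ x in cube d, R x ^ 2 := by
        rw [integral_add ((cubeBdd_interpErr n hc).pow.integrable.const_mul 2)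
          (hI.const_mul 2), integral_const_mul, integral_const_mul]
    _ ≤ _ := by nlinarith [mul_le_mul_of_nonneg_right h3 h4]

/-- The factor by which averaging over cells damps the eigenfunction with index `k + 1`. -/
noncomputable def cellFactor (d n : ℕ) (k : Fin d → ℕ) : ℝ :=
  ∏ j, Real.sinc (((k j : ℝ) + 1) * Real.pi * mesh n / 2)

theorem integral_cellInterp_mul_eigenFun (d n : ℕ) (R : (Fin d → ℝ) → ℝ) (k : Fin d → ℕ) :
    ∫ x in cube d, cellInterp d n R x * eigenFun d k x =
      cellFactor d n k * dInner d n R (eigenFun d k) := by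
  have h1 : ∀ i : Fin d → Fin n, ∫ x in cube d, boxInd d n i x * eigenFun d k x =
      mesh n ^ d * cellFactor d n k * eigenFun d k (gridPt d n i) := by
    intro i
    simp only [boxInd, eigenFun_eq_prod, ← Finset.prod_mul_distrib]
    rw [integral_cube_prod fun j t => cellInd n (i j) t * sineMode (k j) t]
    simp only [integral_cellInd_mul_sineMode, Finset.prod_mul_distrib, Finset.prod_const,
      Finset.card_univ, Fintype.card_fin, cellFactor, gridPt]
  have hI : ∀ i : Fin d → Fin n, IntegrableOn (fun x => R (gridPt d n i) *
      (boxInd d n i x * eigenFun d k x)) (cube d) := fun i =>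
    ((cubeBdd_boxInd i).mul (.of_continuous (continuous_eigenFun d k))).integrable.const_mul _
  have h2 : ∀ x, cellInterp d n R x * eigenFun d k x = ∑ i : Fin d → Fin n, R (gridPt d n i) *
      (boxInd d n i x * eigenFun d k x) := fun x => by
    rw [cellInterp, Finset.sum_mul]
    exact Finset.sum_congr rfl fun i _ => by ring
  simp only [h2]
  rw [integral_finsetSum _ fun i _ => hI i]
  simp only [integral_const_mul, h1]
  rw [dInner, Finset.mul_sum, Finset.mul_sum]
  exact Finset.sum_congr rfl fun i _ => by ring

/-- The set `{0,…,n-1}^d`, encoding the resolved frequencies. -/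
def freqs (d n : ℕ) : Finset (Fin d → ℕ) := Fintype.piFinset fun _ => Finset.range n

theorem mem_freqs {d n : ℕ} {k : Fin d → ℕ} : k ∈ freqs d n ↔ ∀ j, k j < n := by
  simp [freqs]

/-- The discrete eigenvalue `lamD`, as a function on all frequencies. -/
noncomputable def lamDisc (d n : ℕ) (k : Fin d → ℕ) : ℝ :=
  4 / mesh n ^ 2 * ∑ j, Real.sin (((k j : ℝ) + 1) * Real.pi * mesh n / 2) ^ 2

theorem halfAngle_mem {n κ : ℕ} (hκ : κ < n) :
    0 < ((κ : ℝ) + 1) * Real.pi * mesh n / 2 ∧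
      ((κ : ℝ) + 1) * Real.pi * mesh n / 2 < Real.pi / 2 := by
  have hh := mesh_pos n
  have hm := mesh_mul n
  have hp := Real.pi_pos
  have h : (κ : ℝ) + 1 ≤ n := by exact_mod_cast hκ
  have h1 : ((κ : ℝ) + 1) * mesh n < 1 := by nlinarith
  exact ⟨by positivity, by nlinarith⟩

theorem le_lamDisc {d n : ℕ} {k : Fin d → ℕ} (hk : k ∈ freqs d n) :
    4 * ∑ j, ((k j : ℝ) + 1) ^ 2 ≤ lamDisc d n k := by
  have hh := mesh_pos n
  have hp := Real.pi_pos
  rw [lamDisc, Finset.mul_sum, Finset.mul_sum]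
  refine Finset.sum_le_sum fun j _ => ?_
  obtain ⟨h0, h1⟩ := halfAngle_mem (mem_freqs.1 hk j)
  have h2 := Real.mul_le_sin h0.le h1.le
  have h3 : 2 / Real.pi * (((k j : ℝ) + 1) * Real.pi * mesh n / 2) = ((k j : ℝ) + 1) * mesh n := by
    field_simp
  rw [h3] at h2
  calc 4 * ((k j : ℝ) + 1) ^ 2 = 4 / mesh n ^ 2 * (((k j : ℝ) + 1) * mesh n) ^ 2 := by field_simp
    _ ≤ _ := by gcongr

theorem lamDisc_nonneg (d n : ℕ) (k : Fin d → ℕ) : 0 ≤ lamDisc d n k := by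
  have hh := mesh_pos n
  exact mul_nonneg (by positivity) (Finset.sum_nonneg fun j _ => sq_nonneg _)

theorem one_sub_sq_le_sinc {θ : ℝ} (h0 : 0 < θ) (h1 : θ < Real.pi / 2) :
    1 - θ ^ 2 ≤ Real.sinc θ := by
  have hc : 0 < Real.cos θ := Real.cos_pos_of_mem_Ioo ⟨by linarith, h1⟩
  have ht := Real.lt_tan h0 h1
  rw [Real.tan_eq_sin_div_cos, lt_div_iff₀ hc] at ht
  rw [Real.sinc_of_ne_zero h0.ne', le_div_iff₀ h0]
  nlinarith [Real.one_sub_sq_div_two_le_cos (x := θ), pow_pos h0 3]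

theorem half_le_sinc {θ : ℝ} (h0 : 0 < θ) (h1 : θ < Real.pi / 2) : 1 / 2 ≤ Real.sinc θ := by
  have h2 := Real.mul_le_sin h0.le h1.le
  rw [Real.sinc_of_ne_zero h0.ne', le_div_iff₀ h0]
  have h3 : 1 / 2 ≤ 2 / Real.pi := by
    rw [div_le_div_iff₀ two_pos Real.pi_pos]; linarith [Real.pi_le_four]
  nlinarith

theorem one_sub_prod_le_sum {ι : Type*} (s : Finset ι) (a : ι → ℝ)
    (ha : ∀ i ∈ s, 0 ≤ a i ∧ a i ≤ 1) : 1 - ∏ i ∈ s, a i ≤ ∑ i ∈ s, (1 - a i) := by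
  classical
  induction s using Finset.induction_on with
  | empty => simp
  | insert i s hi ih =>
    have h1 := ih fun j hj => ha j (Finset.mem_insert_of_mem hj)
    have h2 := ha i (Finset.mem_insert_self i s)
    have h3 : ∏ j ∈ s, a j ≤ 1 := Finset.prod_le_one
      (fun j hj => (ha j (Finset.mem_insert_of_mem hj)).1)
      fun j hj => (ha j (Finset.mem_insert_of_mem hj)).2
    rw [Finset.prod_insert hi, Finset.sum_insert hi]
    nlinarith

theorem cellFactor_mem {d n : ℕ} {k : Fin d → ℕ} (hk : k ∈ freqs d n) :
    (1 / 2) ^ d ≤ cellFactor d n k ∧ cellFactor d n k ≤ 1 := by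
  have h : ∀ j, 1 / 2 ≤ Real.sinc (((k j : ℝ) + 1) * Real.pi * mesh n / 2) := fun j =>
    half_le_sinc (halfAngle_mem (mem_freqs.1 hk j)).1 (halfAngle_mem (mem_freqs.1 hk j)).2
  constructor
  · have := Finset.prod_le_prod (s := Finset.univ) (fun _ _ => by norm_num) fun j _ => h j
    simpa [cellFactor] using this
  · exact Finset.prod_le_one (fun j _ => le_trans (by norm_num) (h j)) fun j _ => Real.sinc_le_one _

theorem inv_mul_one_sub_cellFactor_sq_le {d n : ℕ} {k : Fin d → ℕ} (hk : k ∈ freqs d n) :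
    (1 + lamDisc d n k)⁻¹ * (1 - cellFactor d n k) ^ 2 ≤ mesh n ^ 2 := by
  have hh := mesh_pos n
  have hl := lamDisc_nonneg d n k
  obtain ⟨h1, h2⟩ := cellFactor_mem hk
  have h1' : 0 ≤ cellFactor d n k := le_trans (by positivity) h1
  have h3 : 1 - cellFactor d n k ≤ ∑ j, (((k j : ℝ) + 1) * Real.pi * mesh n / 2) ^ 2 := by
    refine (one_sub_prod_le_sum Finset.univ _ fun j _ => ?_).trans
      (Finset.sum_le_sum fun j _ => ?_)
    · exact ⟨le_trans (by norm_num) (half_le_sinc (halfAngle_mem (mem_freqs.1 hk j)).1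
        (halfAngle_mem (mem_freqs.1 hk j)).2), Real.sinc_le_one _⟩
    · linarith [one_sub_sq_le_sinc (halfAngle_mem (mem_freqs.1 hk j)).1
        (halfAngle_mem (mem_freqs.1 hk j)).2]
  have h4 : ∑ j, (((k j : ℝ) + 1) * Real.pi * mesh n / 2) ^ 2 =
      Real.pi ^ 2 / 4 * mesh n ^ 2 * ∑ j, ((k j : ℝ) + 1) ^ 2 := by
    rw [Finset.mul_sum]; exact Finset.sum_congr rfl fun j _ => by ring
  have h5 := le_lamDisc hk
  have h6 : Real.pi ^ 2 ≤ 16 := by nlinarith [Real.pi_le_four, Real.pi_pos]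
  have h7 : 0 ≤ ∑ j, ((k j : ℝ) + 1) ^ 2 := Finset.sum_nonneg fun j _ => sq_nonneg _
  rw [inv_mul_le_iff₀ (by positivity)]
  calc (1 - cellFactor d n k) ^ 2 ≤ 1 - cellFactor d n k := by nlinarith
    _ ≤ Real.pi ^ 2 / 4 * mesh n ^ 2 * ∑ j, ((k j : ℝ) + 1) ^ 2 := h3.trans_eq h4
    _ ≤ 16 / 4 * mesh n ^ 2 * ∑ j, ((k j : ℝ) + 1) ^ 2 := by gcongr
    _ ≤ (1 + lamDisc d n k) * mesh n ^ 2 := by nlinarith [sq_nonneg (mesh n)]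

theorem sum_dInner_sq_le {d : ℕ} (hd : d ≤ 3) (n : ℕ) {R : (Fin d → ℝ) → ℝ}
    (hR : ContDiff ℝ 2 R) :
    ∑ k ∈ freqs d n, dInner d n R (eigenFun d k) ^ 2 ≤ 1280 * H2sq d R := by
  have h1 := sum_sq_integral_mul_eigenFun_le (cubeBdd_cellInterp d n R) (freqs d n)
  simp only [integral_cellInterp_mul_eigenFun] at h1
  have h2 := integral_cellInterp_sq_le hd n hR
  calc ∑ k ∈ freqs d n, dInner d n R (eigenFun d k) ^ 2
      ≤ ∑ k ∈ freqs d n, 64 * (cellFactor d n k * dInner d n R (eigenFun d k)) ^ 2 := by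
        refine Finset.sum_le_sum fun k hk => ?_
        have h3 : 1 / 8 ≤ cellFactor d n k := by
          refine le_trans ?_ (cellFactor_mem hk).1
          calc (1 / 8 : ℝ) = (1 / 2) ^ 3 := by norm_num
            _ ≤ _ := pow_le_pow_of_le_one (by norm_num) (by norm_num) hd
        have h4 : 1 ≤ 64 * cellFactor d n k ^ 2 := by nlinarith
        nlinarith [sq_nonneg (dInner d n R (eigenFun d k))]
    _ ≤ 64 * (20 * H2sq d R) := by
        rw [← Finset.mul_sum]; gcongr; exact h1.trans h2
    _ = _ := by ring

/-- The part of `R` lost near the faces `x j = 0` and `x j = 1` when the coordinates below `j`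
have already been restricted to the union of the cells. -/
noncomputable def faceTrunc (d n : ℕ) (R : (Fin d → ℝ) → ℝ) (j : Fin d) (x : Fin d → ℝ) : ℝ :=
  R x * ∏ l with l < j, (1 - edgeInd n (x l))

theorem cubeBdd_faceTrunc {d : ℕ} (n : ℕ) {R : (Fin d → ℝ) → ℝ} (hR : Continuous R) (j : Fin d) :
    CubeBdd d (faceTrunc d n R j) :=
  (CubeBdd.of_continuous hR).mul <| .prod _ fun l =>
    (CubeBdd.of_continuous continuous_const).sub (cubeBdd_edgeInd n l)

theorem integral_faceTrunc_sq_le {d : ℕ} (n : ℕ) {R : (Fin d → ℝ) → ℝ} (hR : Continuous R)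
    (j : Fin d) : ∫ x in cube d, faceTrunc d n R j x ^ 2 ≤ ∫ x in cube d, R x ^ 2 := by
  refine setIntegral_mono_on (cubeBdd_faceTrunc n hR j).pow.integrable
    (integrableOn_cube (hR.pow 2)) (measurableSet_cube d) fun x _ => ?_
  obtain ⟨h0, h1⟩ := prod_one_sub_edgeInd_mem n {l | l < j} x
  rw [faceTrunc, mul_pow]
  exact mul_le_of_le_one_right (sq_nonneg _) (pow_le_one₀ h0 h1)

theorem dInner_sub_integral {d : ℕ} (n : ℕ) {R : (Fin d → ℝ) → ℝ} (hR : Continuous R)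
    (k : Fin d → ℕ) :
    dInner d n R (eigenFun d k) - ∫ x in cube d, R x * eigenFun d k x =
      (1 - cellFactor d n k) * dInner d n R (eigenFun d k) +
        (∫ x in cube d, interpErr d n R x * eigenFun d k x) -
          ∑ j, ∫ x in cube d, faceTrunc d n R j x * (edgeInd n (x j) * eigenFun d k x) := by
  have hφ := CubeBdd.of_continuous (continuous_eigenFun d k)
  have h0 : ∀ x, cellInterp d n R x * eigenFun d k x =
      interpErr d n R x * eigenFun d k x + (R x * eigenFun d k x -
        ∑ j, faceTrunc d n R j x * (edgeInd n (x j) * eigenFun d k x)) := by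
    intro x
    have h1 : ∑ j, faceTrunc d n R j x * (edgeInd n (x j) * eigenFun d k x) =
        R x * eigenFun d k x *
          ∑ j, edgeInd n (x j) * ∏ l with l < j, (1 - edgeInd n (x l)) := by
      rw [Finset.mul_sum]
      exact Finset.sum_congr rfl fun j _ => by rw [faceTrunc]; ring
    rw [h1, cellInterp_eq, Finset.prod_one_sub_ordered]
    ring
  have hI1 := ((cubeBdd_interpErr n hR).mul hφ).integrable
  have hI2 := ((CubeBdd.of_continuous hR).mul hφ).integrable
  have hB := fun j => (cubeBdd_faceTrunc n hR j).mul ((cubeBdd_edgeInd n j).mul hφ)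
  have hI3 := (CubeBdd.sum Finset.univ hB).integrable
  have hI4 := (((CubeBdd.of_continuous hR).mul hφ).sub (CubeBdd.sum Finset.univ hB)).integrable
  have h2 : ∫ x in cube d, cellInterp d n R x * eigenFun d k x =
      (∫ x in cube d, interpErr d n R x * eigenFun d k x) +
        ((∫ x in cube d, R x * eigenFun d k x) -
          ∑ j, ∫ x in cube d, faceTrunc d n R j x * (edgeInd n (x j) * eigenFun d k x)) := by
    simp only [h0]
    rw [integral_add hI1 hI4, integral_sub hI2 hI3,
      integral_finsetSum _ fun j _ => (hB j).integrable]
  rw [integral_cellInterp_mul_eigenFun] at h2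
  linear_combination h2

theorem inv_one_add_lamDisc_le {d n : ℕ} {k : Fin d → ℕ} (hk : k ∈ freqs d n) (j : Fin d) :
    (1 + lamDisc d n k)⁻¹ ≤ (((k j : ℝ) + 1) ^ 2)⁻¹ := by
  refine inv_anti₀ (by positivity) ?_
  have h1 := le_lamDisc hk
  have h2 := Finset.single_le_sum (f := fun j => ((k j : ℝ) + 1) ^ 2)
    (fun j _ => sq_nonneg _) (Finset.mem_univ j)
  have h3 : 0 ≤ ((k j : ℝ) + 1) ^ 2 := sq_nonneg _
  linarith

theorem sum_inv_mul_integral_faceTrunc_sq_le {d : ℕ} (n : ℕ) {R : (Fin d → ℝ) → ℝ}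
    (hR : Continuous R) (j : Fin d) :
    ∑ k ∈ freqs d n, (1 + lamDisc d n k)⁻¹ *
        (∫ x in cube d, faceTrunc d n R j x * (edgeInd n (x j) * eigenFun d k x)) ^ 2 ≤
      Real.pi ^ 2 * mesh n ^ 2 * ∫ x in cube d, R x ^ 2 := by
  have hh := mesh_pos n
  have hm := mesh_mul n
  set I : (Fin d → ℕ) → ℝ := fun k =>
    (∫ x in cube d, faceTrunc d n R j x * (edgeInd n (x j) * eigenFun d k x)) ^ 2
  have hR0 : 0 ≤ ∫ x in cube d, R x ^ 2 := integral_nonneg fun x => sq_nonneg _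
  have hκ : ∀ κ ∈ Finset.range n, ∑ k ∈ freqs d n with k j = κ, (1 + lamDisc d n k)⁻¹ * I k ≤
      Real.pi ^ 2 * mesh n ^ 3 * ∫ x in cube d, R x ^ 2 := by
    intro κ _
    have h1 := (sum_sq_integral_edgeInd_mul_eigenFun_le (cubeBdd_faceTrunc n hR j) j κ
      {k ∈ freqs d n | k j = κ} fun k hk => (Finset.mem_filter.1 hk).2).trans
      (mul_le_mul_of_nonneg_left (integral_faceTrunc_sq_le n hR j) (by positivity))
    calc ∑ k ∈ freqs d n with k j = κ, (1 + lamDisc d n k)⁻¹ * I k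
        ≤ ∑ k ∈ freqs d n with k j = κ, (((κ : ℝ) + 1) ^ 2)⁻¹ * I k := by
          refine Finset.sum_le_sum fun k hk => ?_
          obtain ⟨hk1, hk2⟩ := Finset.mem_filter.1 hk
          have := inv_one_add_lamDisc_le hk1 j
          rw [hk2] at this
          exact mul_le_mul_of_nonneg_right this (sq_nonneg _)
      _ ≤ (((κ : ℝ) + 1) ^ 2)⁻¹ * (((κ : ℝ) + 1) ^ 2 * Real.pi ^ 2 * mesh n ^ 3 *
            ∫ x in cube d, R x ^ 2) := by
          rw [← Finset.mul_sum]
          exact mul_le_mul_of_nonneg_left h1 (by positivity)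
      _ = _ := by field_simp
  rw [← Finset.sum_fiberwise_of_maps_to (s := freqs d n) (t := Finset.range n)
    (g := fun k => k j) fun k hk => Finset.mem_range.2 (mem_freqs.1 hk j)]
  refine (Finset.sum_le_sum hκ).trans ?_
  rw [Finset.sum_const, Finset.card_range, nsmul_eq_mul]
  have h2 : (n : ℝ) * mesh n ≤ 1 := by nlinarith
  have h3 : 0 ≤ Real.pi ^ 2 * mesh n ^ 2 * ∫ x in cube d, R x ^ 2 := by positivity
  calc (n : ℝ) * (Real.pi ^ 2 * mesh n ^ 3 * ∫ x in cube d, R x ^ 2)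
      = (n * mesh n) * (Real.pi ^ 2 * mesh n ^ 2 * ∫ x in cube d, R x ^ 2) := by ring
    _ ≤ _ := mul_le_of_le_one_left h3 h2

/-- Weighted `ℓ²` bound for the quadrature error of the Fourier coefficients. -/
theorem sum_inv_mul_dInner_sub_sq_le {d : ℕ} (hd : d ≤ 3) (n : ℕ) {R : (Fin d → ℝ) → ℝ}
    (hR : ContDiff ℝ 2 R) :
    ∑ k ∈ freqs d n, (1 + lamDisc d n k)⁻¹ *
        (dInner d n R (eigenFun d k) - ∫ x in cube d, R x * eigenFun d k x) ^ 2 ≤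
      5000 * mesh n ^ 2 * H2sq d R := by
  have hc := hR.continuous
  have hH := H2sq_nonneg R
  have hh := mesh_pos n
  set D := fun k => dInner d n R (eigenFun d k)
  set E := fun k => ∫ x in cube d, interpErr d n R x * eigenFun d k x
  set B := fun j k => ∫ x in cube d, faceTrunc d n R j x * (edgeInd n (x j) * eigenFun d k x)
  have hd3 : (d : ℝ) ≤ 3 := by exact_mod_cast hd
  have hE : ∑ k ∈ freqs d n, E k ^ 2 ≤ 9 * mesh n ^ 2 * H2sq d R :=
    (sum_sq_integral_mul_eigenFun_le (cubeBdd_interpErr n hc) _).trans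
      (integral_interpErr_sq_le hd n hR)
  have hpi : Real.pi ^ 2 ≤ 16 := by nlinarith [Real.pi_le_four, Real.pi_pos]
  have hB : ∀ j, ∑ k ∈ freqs d n, (1 + lamDisc d n k)⁻¹ * B j k ^ 2 ≤
      16 * mesh n ^ 2 * H2sq d R := fun j =>
    (sum_inv_mul_integral_faceTrunc_sq_le n hc j).trans (by
      have := integral_sq_le_H2sq R
      gcongr)
  calc _ ≤ ∑ k ∈ freqs d n, (3 * (mesh n ^ 2 * D k ^ 2) + 3 * E k ^ 2 +
        9 * ∑ j, (1 + lamDisc d n k)⁻¹ * B j k ^ 2) := by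
        refine Finset.sum_le_sum fun k hk => ?_
        have hl := lamDisc_nonneg d n k
        have h1 := inv_mul_one_sub_cellFactor_sq_le hk
        have hw0 : 0 ≤ (1 + lamDisc d n k)⁻¹ := by positivity
        have hw1 : (1 + lamDisc d n k)⁻¹ ≤ 1 := inv_le_one_of_one_le₀ (by linarith)
        have h2 : (∑ j, B j k) ^ 2 ≤ 3 * ∑ j, B j k ^ 2 := by
          refine sq_sum_le_card_mul_sum_sq.trans ?_
          rw [Finset.card_univ, Fintype.card_fin]
          gcongr
        rw [dInner_sub_integral n hc k, ← Finset.mul_sum]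
        change (1 + lamDisc d n k)⁻¹ *
          ((1 - cellFactor d n k) * D k + E k - ∑ j, B j k) ^ 2 ≤ _
        set w := (1 + lamDisc d n k)⁻¹
        set s := ∑ j, B j k
        set a := (1 - cellFactor d n k) * D k with ha
        calc w * (a + E k - s) ^ 2 ≤ w * (3 * a ^ 2 + 3 * E k ^ 2 + 3 * s ^ 2) := by
              gcongr
              nlinarith [sq_nonneg (a - E k), sq_nonneg (a + s), sq_nonneg (E k + s)]
          _ = 3 * (w * (1 - cellFactor d n k) ^ 2 * D k ^ 2) + 3 * (w * E k ^ 2) +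
                3 * (w * s ^ 2) := by rw [ha]; ring
          _ ≤ 3 * (mesh n ^ 2 * D k ^ 2) + 3 * (1 * E k ^ 2) +
                3 * (w * (3 * ∑ j, B j k ^ 2)) := by gcongr
          _ = _ := by ring
    _ = 3 * mesh n ^ 2 * ∑ k ∈ freqs d n, D k ^ 2 + 3 * ∑ k ∈ freqs d n, E k ^ 2 +
          9 * ∑ j, ∑ k ∈ freqs d n, (1 + lamDisc d n k)⁻¹ * B j k ^ 2 := by
        rw [Finset.sum_add_distrib, Finset.sum_add_distrib, ← Finset.mul_sum, ← Finset.mul_sum,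
          ← Finset.mul_sum, ← Finset.mul_sum, Finset.sum_comm]
        ring
    _ ≤ 3 * mesh n ^ 2 * (1280 * H2sq d R) + 3 * (9 * mesh n ^ 2 * H2sq d R) +
          9 * (3 * (16 * mesh n ^ 2 * H2sq d R)) := by
        have h3 : ∑ j, ∑ k ∈ freqs d n, (1 + lamDisc d n k)⁻¹ * B j k ^ 2 ≤
            3 * (16 * mesh n ^ 2 * H2sq d R) := by
          refine (Finset.sum_le_sum fun j _ => hB j).trans ?_
          rw [Finset.sum_const, Finset.card_univ, Fintype.card_fin, nsmul_eq_mul]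
          gcongr
        have h4 := sum_dInner_sq_le hd n hR
        gcongr
    _ ≤ _ := by nlinarith [mul_nonneg (sq_nonneg (mesh n)) hH]

theorem lamC_nonneg {d : ℕ} (k : Fin d → ℕ) : 0 ≤ lamC d k :=
  mul_nonneg (sq_nonneg _) (Finset.sum_nonneg fun _ _ => sq_nonneg _)

theorem lamDisc_le_lamC {d n : ℕ} {k : Fin d → ℕ} : lamDisc d n k ≤ lamC d k := by
  have hh := mesh_pos n
  rw [lamDisc, lamC, Finset.mul_sum, Finset.mul_sum]
  refine Finset.sum_le_sum fun j _ => ?_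
  have h0 : 0 ≤ ((k j : ℝ) + 1) * Real.pi * mesh n / 2 := by positivity
  have h1 : Real.sin (((k j : ℝ) + 1) * Real.pi * mesh n / 2) ^ 2 ≤
      (((k j : ℝ) + 1) * Real.pi * mesh n / 2) ^ 2 := by
    rw [sq_le_sq, abs_of_nonneg h0]
    simpa [abs_of_nonneg h0] using Real.abs_sin_le_abs (x := ((k j : ℝ) + 1) * Real.pi * mesh n / 2)
  calc _ ≤ 4 / mesh n ^ 2 * (((k j : ℝ) + 1) * Real.pi * mesh n / 2) ^ 2 := by gcongr
    _ = _ := by field_simp; ring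

theorem sq_sub_sin_sq_le {θ : ℝ} (h0 : 0 < θ) (h1 : θ < Real.pi / 2) :
    θ ^ 2 - Real.sin θ ^ 2 ≤ 2 * θ ^ 4 := by
  have h2 : θ - θ ^ 3 ≤ Real.sin θ := by
    have := one_sub_sq_le_sinc h0 h1
    rw [Real.sinc_of_ne_zero h0.ne', le_div_iff₀ h0] at this
    linarith
  have h3 := Real.sin_le h0.le
  have h5 : 0 ≤ Real.sin θ := Real.sin_nonneg_of_nonneg_of_le_pi h0.le (by linarith)
  calc θ ^ 2 - Real.sin θ ^ 2 = (θ - Real.sin θ) * (θ + Real.sin θ) := by ring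
    _ ≤ θ ^ 3 * (θ + θ) := by gcongr; linarith
    _ = _ := by ring

theorem lamC_sub_lamDisc_le {d n : ℕ} {k : Fin d → ℕ} (hk : k ∈ freqs d n) :
    lamC d k - lamDisc d n k ≤ mesh n ^ 2 / 2 * lamC d k ^ 2 := by
  have hh := mesh_pos n
  have h1 : lamC d k - lamDisc d n k ≤
      mesh n ^ 2 / 2 * ∑ j, (Real.pi ^ 2 * ((k j : ℝ) + 1) ^ 2) ^ 2 := by
    rw [lamC, lamDisc, Finset.mul_sum, Finset.mul_sum, Finset.mul_sum, ← Finset.sum_sub_distrib]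
    refine Finset.sum_le_sum fun j _ => ?_
    obtain ⟨h0, h1⟩ := halfAngle_mem (mem_freqs.1 hk j)
    set θ := ((k j : ℝ) + 1) * Real.pi * mesh n / 2 with hθ
    have h4 := sq_sub_sin_sq_le h0 h1
    calc Real.pi ^ 2 * ((k j : ℝ) + 1) ^ 2 - 4 / mesh n ^ 2 * Real.sin θ ^ 2
        = 4 / mesh n ^ 2 * (θ ^ 2 - Real.sin θ ^ 2) := by rw [hθ]; field_simp; ring
      _ ≤ 4 / mesh n ^ 2 * (2 * θ ^ 4) := by gcongr
      _ = _ := by rw [hθ]; field_simp; ring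
  refine h1.trans ?_
  gcongr
  rw [lamC, Finset.mul_sum]
  exact Finset.sum_sq_le_sq_sum_of_nonneg fun j _ => by positivity

theorem inv_one_add_lam_sub_mem {d n : ℕ} {k : Fin d → ℕ} (hk : k ∈ freqs d n) :
    0 ≤ (1 + lamDisc d n k)⁻¹ - (1 + lamC d k)⁻¹ ∧
      (1 + lamDisc d n k)⁻¹ - (1 + lamC d k)⁻¹ ≤ 2 * mesh n ^ 2 := by
  have ha := lamDisc_nonneg d n k
  have hb := lamC_nonneg k
  have hab := lamDisc_le_lamC (n := n) (k := k)
  have hs := lamC_sub_lamDisc_le hk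
  have h4 : lamC d k / 4 ≤ lamDisc d n k := by
    refine le_trans ?_ (le_lamDisc hk)
    have h6 : Real.pi ^ 2 ≤ 16 := by nlinarith [Real.pi_le_four, Real.pi_pos]
    have h7 : 0 ≤ ∑ j, ((k j : ℝ) + 1) ^ 2 := Finset.sum_nonneg fun j _ => sq_nonneg _
    unfold lamC
    nlinarith
  constructor
  · exact sub_nonneg.2 (inv_anti₀ (by positivity) (by linarith))
  · rw [inv_sub_inv (by positivity) (by positivity), div_le_iff₀ (by positivity)]
    have h5 : lamC d k ^ 2 / 4 ≤ (1 + lamDisc d n k) * (1 + lamC d k) := by nlinarith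
    calc 1 + lamC d k - (1 + lamDisc d n k) ≤ mesh n ^ 2 / 2 * lamC d k ^ 2 := by linarith
      _ = 2 * mesh n ^ 2 * (lamC d k ^ 2 / 4) := by ring
      _ ≤ _ := by gcongr

theorem inv_one_add_lamC_le {d n : ℕ} {k : Fin d → ℕ} (hk : k ∉ freqs d n) :
    (1 + lamC d k)⁻¹ ≤ mesh n ^ 2 := by
  simp only [mem_freqs, not_forall, not_lt] at hk
  obtain ⟨j, hj⟩ := hk
  have hh := mesh_pos n
  have hm := mesh_mul n
  have hj' : (n : ℝ) ≤ k j := by exact_mod_cast hj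
  have hn : (0 : ℝ) ≤ n := Nat.cast_nonneg n
  have hp : 1 ≤ Real.pi ^ 2 := by nlinarith [Real.pi_gt_three]
  have h1 := Finset.single_le_sum (f := fun j => ((k j : ℝ) + 1) ^ 2)
    (fun j _ => sq_nonneg _) (Finset.mem_univ j)
  have h2 : ((n : ℝ) + 1) ^ 2 ≤ ((k j : ℝ) + 1) ^ 2 := by gcongr
  have h3 : ((n : ℝ) + 1) ^ 2 ≤ lamC d k := by
    refine (h2.trans h1).trans ?_
    exact le_mul_of_one_le_left (Finset.sum_nonneg fun j _ => sq_nonneg _) hp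
  rw [inv_le_iff_one_le_mul₀ (by linarith [lamC_nonneg k])]
  calc (1 : ℝ) = mesh n ^ 2 * ((n : ℝ) + 1) ^ 2 := by rw [← mul_pow, mul_comm, hm, one_pow]
    _ ≤ _ := by gcongr; linarith

theorem sum_sq_coeff_le {d : ℕ} {R : (Fin d → ℝ) → ℝ} (hR : Continuous R)
    (s : Finset (Fin d → ℕ)) :
    ∑ k ∈ s, (∫ x in cube d, R x * eigenFun d k x) ^ 2 ≤ H2sq d R :=
  (sum_sq_integral_mul_eigenFun_le (.of_continuous hR) s).trans (integral_sq_le_H2sq R)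

theorem inv_one_add_lamC_mem {d : ℕ} (k : Fin d → ℕ) :
    0 ≤ (1 + lamC d k)⁻¹ ∧ (1 + lamC d k)⁻¹ ≤ 1 := by
  have := lamC_nonneg k
  exact ⟨by positivity, inv_le_one_of_one_le₀ (by linarith)⟩

theorem tsum_sub_sum_freqs_mem {d : ℕ} (n : ℕ) {R : (Fin d → ℝ) → ℝ} (hR : Continuous R) :
    |(∑ k ∈ freqs d n, (1 + lamC d k)⁻¹ * (∫ x in cube d, R x * eigenFun d k x) ^ 2) -
      ∑' k, (1 + lamC d k)⁻¹ * (∫ x in cube d, R x * eigenFun d k x) ^ 2| ≤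
        mesh n ^ 2 * H2sq d R := by
  classical
  set a : (Fin d → ℕ) → ℝ :=
    fun k => (1 + lamC d k)⁻¹ * (∫ x in cube d, R x * eigenFun d k x) ^ 2
  have ha : ∀ k, 0 ≤ a k := fun k => mul_nonneg (inv_one_add_lamC_mem k).1 (sq_nonneg _)
  have hle : ∀ s : Finset (Fin d → ℕ), ∑ k ∈ s, a k ≤
      (∑ k ∈ freqs d n, a k) + mesh n ^ 2 * H2sq d R := by
    intro s
    have h1 : ∑ k ∈ s \ freqs d n, a k ≤ mesh n ^ 2 * H2sq d R := by
      calc ∑ k ∈ s \ freqs d n, a k ≤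
          ∑ k ∈ s \ freqs d n, mesh n ^ 2 * (∫ x in cube d, R x * eigenFun d k x) ^ 2 :=
            Finset.sum_le_sum fun k hk => mul_le_mul_of_nonneg_right
              (inv_one_add_lamC_le (Finset.mem_sdiff.1 hk).2) (sq_nonneg _)
        _ ≤ _ := by
            rw [← Finset.mul_sum]
            exact mul_le_mul_of_nonneg_left (sum_sq_coeff_le hR _) (sq_nonneg _)
    have h2 : ∑ k ∈ s ∩ freqs d n, a k ≤ ∑ k ∈ freqs d n, a k :=
      Finset.sum_le_sum_of_subset_of_nonneg Finset.inter_subset_right fun k _ _ => ha k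
    rw [← Finset.sum_inter_add_sum_sdiff s (freqs d n) a]
    linarith
  have hs : Summable a := summable_of_sum_le ha hle
  have h1 : ∑ k ∈ freqs d n, a k ≤ ∑' k, a k := hs.sum_le_tsum _ fun k _ => ha k
  have h2 : ∑' k, a k ≤ (∑ k ∈ freqs d n, a k) + mesh n ^ 2 * H2sq d R :=
    hs.tsum_le_of_sum_le hle
  rw [abs_le]
  constructor <;> linarith

/-- An `ℓ²` bound for the quadrature error of the Fourier coefficients yields a bound for the
error in the stochastically weak norm. -/
theorem abs_sum_sub_tsum_le {d : ℕ} (hd : d ≤ 3) (n : ℕ) {R : (Fin d → ℝ) → ℝ}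
    (hR : ContDiff ℝ 2 R) {K ρ : ℝ} (hρ : 0 < ρ) (hmρ : mesh n ^ 2 ≤ ρ)
    (hK : ∑ k ∈ freqs d n, (1 + lamDisc d n k)⁻¹ *
        (dInner d n R (eigenFun d k) - ∫ x in cube d, R x * eigenFun d k x) ^ 2 ≤
      K * ρ ^ 2 * H2sq d R) :
    |(∑ k ∈ freqs d n, (1 + lamDisc d n k)⁻¹ * dInner d n R (eigenFun d k) ^ 2) -
      ∑' k, (1 + lamC d k)⁻¹ * (∫ x in cube d, R x * eigenFun d k x) ^ 2| ≤
        (K / 2 + 1284) * ρ * H2sq d R := by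
  have hc := hR.continuous
  have hH := H2sq_nonneg R
  set D := fun k => dInner d n R (eigenFun d k)
  set c := fun k => ∫ x in cube d, R x * eigenFun d k x
  set w := fun k => (1 + lamDisc d n k)⁻¹
  set v := fun k => (1 + lamC d k)⁻¹
  change ∑ k ∈ freqs d n, w k * (D k - c k) ^ 2 ≤ K * ρ ^ 2 * H2sq d R at hK
  change |(∑ k ∈ freqs d n, w k * D k ^ 2) - ∑' k, v k * c k ^ 2| ≤ _
  have hw : ∀ k, 0 ≤ w k ∧ w k ≤ 1 := fun k => by
    have := lamDisc_nonneg d n k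
    exact ⟨by positivity, inv_le_one_of_one_le₀ (by linarith)⟩
  have hD : ∑ k ∈ freqs d n, D k ^ 2 ≤ 1280 * H2sq d R := sum_dInner_sq_le hd n hR
  have hcs : ∑ k ∈ freqs d n, c k ^ 2 ≤ H2sq d R := sum_sq_coeff_le hc _
  have h3 : |(∑ k ∈ freqs d n, v k * c k ^ 2) - ∑' k, v k * c k ^ 2| ≤ mesh n ^ 2 * H2sq d R :=
    tsum_sub_sum_freqs_mem n hc
  have h1 : |∑ k ∈ freqs d n, w k * (D k ^ 2 - c k ^ 2)| ≤ (K / 2 + 1281) * ρ * H2sq d R := by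
    calc |∑ k ∈ freqs d n, w k * (D k ^ 2 - c k ^ 2)|
        ≤ ∑ k ∈ freqs d n, |w k * (D k ^ 2 - c k ^ 2)| := Finset.abs_sum_le_sum_abs _ _
      _ ≤ ∑ k ∈ freqs d n, (1 / (2 * ρ) * (w k * (D k - c k) ^ 2) +
            ρ * (D k ^ 2 + c k ^ 2)) := by
          refine Finset.sum_le_sum fun k _ => ?_
          obtain ⟨hw0, hw1⟩ := hw k
          rw [abs_mul, abs_of_nonneg hw0]
          have hab : |D k ^ 2 - c k ^ 2| ≤
              1 / (2 * ρ) * (D k - c k) ^ 2 + ρ * (D k ^ 2 + c k ^ 2) := by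
            have e1 : 1 / (2 * ρ) * (D k - c k) ^ 2 + ρ / 2 * (D k + c k) ^ 2 -
                |D k - c k| * |D k + c k| =
                1 / (2 * ρ) * (|D k - c k| - ρ * |D k + c k|) ^ 2 := by
              rw [← sq_abs (D k - c k), ← sq_abs (D k + c k)]
              field_simp
              ring
            have e2 : 0 ≤ 1 / (2 * ρ) * (|D k - c k| - ρ * |D k + c k|) ^ 2 := by positivity
            have e3 : |D k ^ 2 - c k ^ 2| = |D k - c k| * |D k + c k| := by
              rw [← abs_mul]; congr 1; ring
            nlinarith [mul_nonneg hρ.le (sq_nonneg (D k - c k))]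
          have hp : 0 ≤ ρ * (D k ^ 2 + c k ^ 2) := by positivity
          calc w k * |D k ^ 2 - c k ^ 2| ≤
              w k * (1 / (2 * ρ) * (D k - c k) ^ 2 + ρ * (D k ^ 2 + c k ^ 2)) := by gcongr
            _ ≤ _ := by nlinarith
      _ = 1 / (2 * ρ) * ∑ k ∈ freqs d n, w k * (D k - c k) ^ 2 +
            ρ * (∑ k ∈ freqs d n, D k ^ 2 + ∑ k ∈ freqs d n, c k ^ 2) := by
          rw [Finset.sum_add_distrib, ← Finset.mul_sum, ← Finset.mul_sum, Finset.sum_add_distrib]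
      _ ≤ 1 / (2 * ρ) * (K * ρ ^ 2 * H2sq d R) + ρ * (1280 * H2sq d R + H2sq d R) := by gcongr
      _ = _ := by field_simp; ring
  have h2 : |∑ k ∈ freqs d n, (w k - v k) * c k ^ 2| ≤ 2 * mesh n ^ 2 * H2sq d R := by
    rw [abs_of_nonneg (Finset.sum_nonneg fun k hk =>
      mul_nonneg (inv_one_add_lam_sub_mem hk).1 (sq_nonneg _))]
    calc ∑ k ∈ freqs d n, (w k - v k) * c k ^ 2 ≤
        ∑ k ∈ freqs d n, 2 * mesh n ^ 2 * c k ^ 2 :=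
          Finset.sum_le_sum fun k hk => mul_le_mul_of_nonneg_right
            (inv_one_add_lam_sub_mem hk).2 (sq_nonneg _)
      _ ≤ _ := by rw [← Finset.mul_sum]; gcongr
  have h4 : mesh n ^ 2 * H2sq d R ≤ ρ * H2sq d R := by gcongr
  have h5 : (∑ k ∈ freqs d n, w k * D k ^ 2) - ∑' k, v k * c k ^ 2 =
      (∑ k ∈ freqs d n, w k * (D k ^ 2 - c k ^ 2)) + (∑ k ∈ freqs d n, (w k - v k) * c k ^ 2) +
        ((∑ k ∈ freqs d n, v k * c k ^ 2) - ∑' k, v k * c k ^ 2) := by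
    have : ∑ k ∈ freqs d n, w k * D k ^ 2 = (∑ k ∈ freqs d n, w k * (D k ^ 2 - c k ^ 2)) +
        (∑ k ∈ freqs d n, (w k - v k) * c k ^ 2) + ∑ k ∈ freqs d n, v k * c k ^ 2 := by
      rw [← Finset.sum_add_distrib, ← Finset.sum_add_distrib]
      exact Finset.sum_congr rfl fun k _ => by ring
    rw [this]; ring
  rw [h5]
  refine (abs_add_three _ _ _).trans ?_
  linarith

theorem sub_sin_le_sq {y : ℝ} (h0 : 0 ≤ y) : y - Real.sin y ≤ y ^ 2 := by
  rcases h0.eq_or_lt with rfl | h0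
  · simp
  · rcases le_or_gt y 6 with h1 | h1
    · nlinarith [Real.sin_gt_sub_cube h0, pow_pos h0 2]
    · nlinarith [Real.neg_one_le_sin y]

theorem abs_sin_add_sub_le (x : ℝ) {y : ℝ} (h0 : 0 ≤ y) :
    |Real.sin (x + y) - Real.sin x - y * Real.cos x| ≤ 2 * y ^ 2 := by
  have h1 : Real.sin (x + y) - Real.sin x - y * Real.cos x =
      -(Real.sin x * (1 - Real.cos y)) - Real.cos x * (y - Real.sin y) := by
    rw [Real.sin_add]; ring
  have h2 : |Real.sin x * (1 - Real.cos y)| ≤ 1 * y ^ 2 := by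
    rw [abs_mul]
    refine mul_le_mul (Real.abs_sin_le_one x) ?_ (abs_nonneg _) zero_le_one
    rw [abs_of_nonneg (sub_nonneg.2 (Real.cos_le_one y))]
    nlinarith [Real.one_sub_sq_div_two_le_cos (x := y), sq_nonneg y]
  have h3 : |Real.cos x * (y - Real.sin y)| ≤ 1 * y ^ 2 := by
    rw [abs_mul]
    refine mul_le_mul (Real.abs_cos_le_one x) ?_ (abs_nonneg _) zero_le_one
    rw [abs_of_nonneg (sub_nonneg.2 (Real.sin_le h0))]
    exact sub_sin_le_sq h0
  rw [h1]
  refine (abs_sub _ _).trans ?_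
  rw [abs_neg]
  linarith

theorem abs_sin_sub_linearInterp_le {α a h t : ℝ} (hα : 0 ≤ α) (hh : 0 < h) (hat : a ≤ t)
    (hth : t ≤ a + h) :
    |Real.sin (α * a) + (t - a) * ((Real.sin (α * (a + h)) - Real.sin (α * a)) / h) -
      Real.sin (α * t)| ≤ 4 * α ^ 2 * h ^ 2 := by
  have h1 := abs_sin_add_sub_le (α * a) (mul_nonneg hα hh.le)
  have h2 := abs_sin_add_sub_le (α * a) (mul_nonneg hα (sub_nonneg.2 hat))
  rw [show α * a + α * h = α * (a + h) by ring] at h1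
  rw [show α * a + α * (t - a) = α * t by ring] at h2
  have hr0 : 0 ≤ (t - a) / h := div_nonneg (sub_nonneg.2 hat) hh.le
  have hr1 : (t - a) / h ≤ 1 := by rw [div_le_one hh]; linarith
  have h3 : Real.sin (α * a) + (t - a) * ((Real.sin (α * (a + h)) - Real.sin (α * a)) / h) -
      Real.sin (α * t) = (t - a) / h *
        (Real.sin (α * (a + h)) - Real.sin (α * a) - α * h * Real.cos (α * a)) -
        (Real.sin (α * t) - Real.sin (α * a) - α * (t - a) * Real.cos (α * a)) := by
    field_simp
    ring
  have h4 : |(t - a) / h *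
      (Real.sin (α * (a + h)) - Real.sin (α * a) - α * h * Real.cos (α * a))| ≤
        1 * (2 * (α * h) ^ 2) := by
    rw [abs_mul, abs_of_nonneg hr0]
    exact mul_le_mul hr1 h1 (abs_nonneg _) zero_le_one
  have h5 : (α * (t - a)) ^ 2 ≤ (α * h) ^ 2 := by
    refine pow_le_pow_left₀ (mul_nonneg hα (sub_nonneg.2 hat)) ?_ 2
    exact mul_le_mul_of_nonneg_left (by linarith) hα
  rw [h3]
  refine (abs_sub _ _).trans ?_
  calc _ ≤ 1 * (2 * (α * h) ^ 2) + 2 * (α * h) ^ 2 := add_le_add h4 (h2.trans (by linarith))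
    _ = _ := by ring

theorem sum_range_diff_mul_diff (u F : ℕ → ℝ) (n : ℕ) :
    ∑ i ∈ Finset.range (n + 1), (u (i + 1) - u i) * (F (i + 1) - F i) =
      F (n + 1) * (u (n + 1) - u n) - F 0 * (u 1 - u 0) -
        ∑ i ∈ Finset.range n, F (i + 1) * (u (i + 2) - 2 * u (i + 1) + u i) := by
  induction n with
  | zero => simp; ring
  | succ n ih => rw [Finset.sum_range_succ, ih, Finset.sum_range_succ]; ring

theorem sin_second_diff (θ : ℝ) (i : ℕ) :
    Real.sin (2 * θ * ((i + 2 : ℕ) : ℝ)) - 2 * Real.sin (2 * θ * ((i + 1 : ℕ) : ℝ)) +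
      Real.sin (2 * θ * (i : ℝ)) =
        -(4 * Real.sin θ ^ 2) * Real.sin (2 * θ * ((i + 1 : ℕ) : ℝ)) := by
  have h1 : 2 * θ * ((i + 2 : ℕ) : ℝ) = 2 * θ * ((i + 1 : ℕ) : ℝ) + 2 * θ := by push_cast; ring
  have h2 : 2 * θ * (i : ℝ) = 2 * θ * ((i + 1 : ℕ) : ℝ) - 2 * θ := by push_cast; ring
  rw [h1, h2, Real.sin_add, Real.sin_sub, Real.cos_two_mul, Real.cos_sq']
  ring

section OneDim

variable {f f' f'' : ℝ → ℝ}

theorem integral_deriv2_mul_affine (hf : ∀ t, HasDerivAt f (f' t) t)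
    (hf' : ∀ t, HasDerivAt f' (f'' t) t) (hc : Continuous f'') (a b p q : ℝ) :
    ∫ t in a..b, f'' t * (p + (t - a) * q) =
      f' b * (p + (b - a) * q) - f' a * p - q * (f b - f a) := by
  have h1 : ∀ t ∈ Set.uIcc a b, HasDerivAt (fun t => f' t * (p + (t - a) * q) - q * f t)
      (f'' t * (p + (t - a) * q)) t := by
    intro t _
    have h2 : HasDerivAt (fun t => p + (t - a) * q) (1 * q) t :=
      (((hasDerivAt_id t).sub_const a).mul_const q).const_add p
    have h3 := ((hf' t).mul h2).sub ((hf t).const_mul q)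
    refine h3.congr_deriv ?_
    ring
  rw [intervalIntegral.integral_eq_sub_of_hasDerivAt h1
    (Continuous.intervalIntegrable (by fun_prop) _ _)]
  ring

theorem integral_deriv2_mul_sin (hf : ∀ t, HasDerivAt f (f' t) t)
    (hf' : ∀ t, HasDerivAt f' (f'' t) t) (hc : Continuous f'') (α : ℝ) (hα : Real.sin α = 0) :
    (∫ t in (0 : ℝ)..1, f'' t * Real.sin (α * t)) +
        α ^ 2 * ∫ t in (0 : ℝ)..1, f t * Real.sin (α * t) =
      α * (f 0 - Real.cos α * f 1) := by
  have hfc : Continuous f := continuous_iff_continuousAt.2 fun t => (hf t).continuousAt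
  have h1 : ∀ t ∈ Set.uIcc (0 : ℝ) 1,
      HasDerivAt (fun t => f' t * Real.sin (α * t) - α * (f t * Real.cos (α * t)))
        (f'' t * Real.sin (α * t) + α ^ 2 * (f t * Real.sin (α * t))) t := by
    intro t _
    have h2 : HasDerivAt (fun t => α * t) α t := by
      simpa using (hasDerivAt_id t).const_mul α
    have h3 := ((hf' t).mul h2.sin).sub (((hf t).mul h2.cos).const_mul α)
    refine h3.congr_deriv ?_
    ring
  rw [← intervalIntegral.integral_const_mul, ← intervalIntegral.integral_add
    (Continuous.intervalIntegrable (by fun_prop) _ _)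
    (Continuous.intervalIntegrable (by fun_prop) _ _),
    intervalIntegral.integral_eq_sub_of_hasDerivAt h1
    (Continuous.intervalIntegrable (by fun_prop) _ _)]
  simp [hα]
  ring

theorem abs_sum_integral_affine_sub_le (hf : ∀ t, HasDerivAt f (f' t) t)
    (hf' : ∀ t, HasDerivAt f' (f'' t) t) (hc : Continuous f'') {n : ℕ} {α : ℝ}
    (hα : 0 ≤ α) (hs : Real.sin α = 0) :
    |(f 1 * Real.sin (α * (n * mesh n)) + f 0 * Real.sin (α * mesh n) +
        ∑ i ∈ Finset.range n, f ((i + 1 : ℕ) * mesh n) *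
          (Real.sin (α * ((i + 2 : ℕ) * mesh n)) - 2 * Real.sin (α * ((i + 1 : ℕ) * mesh n)) +
            Real.sin (α * (i * mesh n)))) / mesh n -
        ∫ t in (0 : ℝ)..1, f'' t * Real.sin (α * t)| ≤
      4 * α ^ 2 * mesh n ^ 2 * ∫ t in (0 : ℝ)..1, |f'' t| := by
  have hh := mesh_pos n
  have hm := mesh_mul n
  set h := mesh n with hh_def
  set x : ℕ → ℝ := fun i => i * h with hx
  have hx0 : x 0 = 0 := by simp [hx]
  have hx1 : x (n + 1) = 1 := by simp only [hx]; push_cast; exact hm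
  have hxs : ∀ i, x (i + 1) = x i + h := fun i => by simp only [hx]; push_cast; ring
  set u : ℕ → ℝ := fun i => Real.sin (α * x i) with hu
  set L : ℕ → ℝ → ℝ := fun i t => u i + (t - x i) * ((u (i + 1) - u i) / h) with hL
  have hLc : ∀ i, Continuous (L i) := fun i => by simp only [hL]; fun_prop
  have hcell : ∀ i, ∫ t in x i..x (i + 1), f'' t * L i t =
      (f' (x (i + 1)) * u (i + 1) - f' (x i) * u i) -
        (u (i + 1) - u i) * (f (x (i + 1)) - f (x i)) / h := by
    intro i
    simp only [hL]
    rw [integral_deriv2_mul_affine hf hf' hc, hxs i]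
    field_simp
    ring
  have hsum : ∑ i ∈ Finset.range (n + 1), ∫ t in x i..x (i + 1), f'' t * L i t =
      (f 1 * u n + f 0 * u 1 +
        ∑ i ∈ Finset.range n, f (x (i + 1)) * (u (i + 2) - 2 * u (i + 1) + u i)) / h := by
    simp only [hcell]
    rw [Finset.sum_sub_distrib, Finset.sum_range_sub (fun i => f' (x i) * u i),
      ← Finset.sum_div, sum_range_diff_mul_diff u fun i => f (x i)]
    have hu0 : u 0 = 0 := by simp [hu, hx0]
    have hu1 : u (n + 1) = 0 := by simp only [hu, hx1, mul_one, hs]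
    simp only [hu0, hu1, hx0, hx1]
    ring
  have hadj : ∀ g : ℝ → ℝ, Continuous g →
      ∑ i ∈ Finset.range (n + 1), ∫ t in x i..x (i + 1), g t = ∫ t in (0 : ℝ)..1, g t := by
    intro g hg
    rw [intervalIntegral.sum_integral_adjacent_intervals fun i _ => hg.intervalIntegrable _ _,
      hx0, hx1]
  have hsin : Continuous fun t => f'' t * Real.sin (α * t) := by fun_prop
  have hu1' : u 1 = Real.sin (α * h) := by simp [hu, hx]
  have hgoal : (f 1 * Real.sin (α * (n * h)) + f 0 * Real.sin (α * h) +
        ∑ i ∈ Finset.range n, f ((i + 1 : ℕ) * h) *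
          (Real.sin (α * ((i + 2 : ℕ) * h)) - 2 * Real.sin (α * ((i + 1 : ℕ) * h)) +
            Real.sin (α * (i * h)))) / h =
      ∑ i ∈ Finset.range (n + 1), ∫ t in x i..x (i + 1), f'' t * L i t := by
    rw [hsum, hu1']
  rw [hgoal, ← hadj _ hsin, ← hadj _ hc.abs, ← Finset.sum_sub_distrib, Finset.mul_sum]
  refine (Finset.abs_sum_le_sum_abs _ _).trans (Finset.sum_le_sum fun i _ => ?_)
  have hle : x i ≤ x (i + 1) := by rw [hxs]; linarith
  have hLi : Continuous fun t => f'' t * L i t := hc.mul (hLc i)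
  rw [← intervalIntegral.integral_sub (hLi.intervalIntegrable _ _)
    (hsin.intervalIntegrable _ _), ← intervalIntegral.integral_const_mul]
  refine (intervalIntegral.abs_integral_le_integral_abs hle).trans ?_
  refine intervalIntegral.integral_mono_on hle
    ((hLi.sub hsin).abs.intervalIntegrable _ _)
    ((continuous_const.mul hc.abs).intervalIntegrable _ _) fun t ht => ?_
  rw [← mul_sub, abs_mul, mul_comm]
  refine mul_le_mul_of_nonneg_right ?_ (abs_nonneg _)
  have := abs_sin_sub_linearInterp_le hα hh ht.1 (ht.2.trans_eq (hxs i))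
  rw [← hxs i] at this
  exact this

theorem inv_sub_cot_mem {θ : ℝ} (h0 : 0 < θ) (h1 : θ < Real.pi / 2) :
    |Real.cos θ / Real.sin θ - 1 / θ| ≤ θ := by
  have hs : θ / 2 ≤ Real.sin θ := by
    have := half_le_sinc h0 h1
    rw [Real.sinc_of_ne_zero h0.ne', le_div_iff₀ h0] at this
    linarith
  have hs0 : 0 < Real.sin θ := by linarith
  have hc := Real.one_sub_sq_div_two_le_cos (x := θ)
  have hc0 : 0 < Real.cos θ := Real.cos_pos_of_mem_Ioo ⟨by linarith, h1⟩
  have ht := Real.lt_tan h0 h1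
  rw [Real.tan_eq_sin_div_cos, lt_div_iff₀ hc0] at ht
  rw [div_sub_div _ _ hs0.ne' h0.ne', abs_div, abs_of_pos (mul_pos hs0 h0),
    div_le_iff₀ (mul_pos hs0 h0), abs_le]
  have h3 := Real.sin_le h0.le
  constructor
  · nlinarith [pow_pos h0 2, mul_le_mul_of_nonneg_left hs (sq_nonneg θ),
      mul_le_mul_of_nonneg_left hc h0.le]
  · have : 0 ≤ θ * (Real.sin θ * θ) := by positivity
    nlinarith

end OneDim

/-- The one-dimensional discrete eigenvalue `4 sin² θ / h²` is comparable to `(2θ/h)²`. -/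
theorem discreteEigenvalue_bounds {θ h : ℝ} (h0 : 0 < θ) (h1 : θ < Real.pi / 2) (hh : 0 < h) :
    (2 * θ / h) ^ 2 / 4 ≤ 4 * Real.sin θ ^ 2 / h ^ 2 ∧
      |(4 * Real.sin θ ^ 2 / h ^ 2)⁻¹ - ((2 * θ / h) ^ 2)⁻¹| ≤ 2 * h ^ 2 := by
  have hs0 : θ / 2 ≤ Real.sin θ := by
    have := half_le_sinc h0 h1
    rw [Real.sinc_of_ne_zero h0.ne', le_div_iff₀ h0] at this
    linarith
  have hs : 0 < Real.sin θ := by linarith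
  have hs1 := Real.sin_le h0.le
  have hsq : Real.sin θ ^ 2 ≤ θ ^ 2 := by gcongr
  have hsq' : θ ^ 2 / 4 ≤ Real.sin θ ^ 2 := by nlinarith
  refine ⟨?_, ?_⟩
  · rw [div_pow, div_div, mul_comm _ (4 : ℝ), ← div_div]
    gcongr
    linarith
  · have h2 : (4 * Real.sin θ ^ 2 / h ^ 2)⁻¹ - ((2 * θ / h) ^ 2)⁻¹ =
        h ^ 2 * ((θ ^ 2 - Real.sin θ ^ 2) / (4 * Real.sin θ ^ 2 * θ ^ 2)) := by
      field_simp
      ring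
    have h3 : (θ ^ 2 - Real.sin θ ^ 2) / (4 * Real.sin θ ^ 2 * θ ^ 2) ≤ 2 := by
      rw [div_le_iff₀ (by positivity)]
      calc _ ≤ 2 * θ ^ 4 := sq_sub_sin_sq_le h0 h1
        _ = 2 * (4 * (θ ^ 2 / 4) * θ ^ 2) := by ring
        _ ≤ _ := by gcongr
    have h4 : 0 ≤ (θ ^ 2 - Real.sin θ ^ 2) / (4 * Real.sin θ ^ 2 * θ ^ 2) :=
      div_nonneg (sub_nonneg.2 hsq) (by positivity)
    rw [h2, abs_of_nonneg (by positivity), mul_comm]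
    exact mul_le_mul_of_nonneg_right h3 (by positivity)

section OneDim

variable {f f' f'' : ℝ → ℝ}

/-- Quadrature error of the trapezoidal rule for a Fourier sine coefficient. -/
theorem abs_trapezoid_sin_sub_le (hf : ∀ t, HasDerivAt f (f' t) t)
    (hf' : ∀ t, HasDerivAt f' (f'' t) t) (hc : Continuous f'') {n κ : ℕ} (hκ : κ < n) :
    |mesh n * (∑ i ∈ Finset.range n, f ((i + 1 : ℕ) * mesh n) *
          Real.sin (((κ : ℝ) + 1) * Real.pi * ((i + 1 : ℕ) * mesh n))) -
        ∫ t in (0 : ℝ)..1, f t * Real.sin (((κ : ℝ) + 1) * Real.pi * t)| ≤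
      20 * mesh n ^ 2 * ((κ : ℝ) + 1) * (|f 0| + |f 1| + ∫ t in (0 : ℝ)..1, |f'' t|) := by
  have hh := mesh_pos n
  have hm := mesh_mul n
  obtain ⟨hθ0, hθ1⟩ := halfAngle_mem hκ
  set α := ((κ : ℝ) + 1) * Real.pi with hα_def
  have hα : 0 < α := by positivity
  set θ := α * mesh n / 2 with hθ
  have hsα : Real.sin α = 0 := by
    have := Real.sin_nat_mul_pi (κ + 1)
    push_cast at this
    exact this
  have hA := abs_sum_integral_affine_sub_le hf hf' hc (n := n) hα.le hsα
  have hJ := integral_deriv2_mul_sin hf hf' hc α hsα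
  have hnh : Real.sin (α * (n * mesh n)) = -(Real.cos α * Real.sin (2 * θ)) := by
    have : α * (n * mesh n) = α - 2 * θ := by rw [hθ]; linear_combination α * hm
    rw [this, Real.sin_sub, hsα]; ring
  have hh1 : Real.sin (α * mesh n) = Real.sin (2 * θ) := by congr 1; rw [hθ]; ring
  have hdiff : ∀ i : ℕ, f ((i + 1 : ℕ) * mesh n) *
      (Real.sin (α * ((i + 2 : ℕ) * mesh n)) - 2 * Real.sin (α * ((i + 1 : ℕ) * mesh n)) +
        Real.sin (α * (i * mesh n))) = -(4 * Real.sin θ ^ 2) *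
          (f ((i + 1 : ℕ) * mesh n) * Real.sin (α * ((i + 1 : ℕ) * mesh n))) := by
    intro i
    have h1 : ∀ y : ℝ, α * (y * mesh n) = 2 * θ * y := fun y => by rw [hθ]; ring
    rw [h1, h1, h1, sin_second_diff]
    ring
  rw [hnh, hh1] at hA
  simp only [hdiff] at hA
  rw [← Finset.mul_sum] at hA
  set S := ∑ i ∈ Finset.range n, f ((i + 1 : ℕ) * mesh n) *
    Real.sin (α * ((i + 1 : ℕ) * mesh n)) with hS
  set I := ∫ t in (0 : ℝ)..1, f t * Real.sin (α * t) with hI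
  set J := ∫ t in (0 : ℝ)..1, f'' t * Real.sin (α * t) with hJ_def
  set G := ∫ t in (0 : ℝ)..1, |f'' t| with hG
  set A := (f 1 * -(Real.cos α * Real.sin (2 * θ)) + f 0 * Real.sin (2 * θ) +
    -(4 * Real.sin θ ^ 2) * S) / mesh n with hA_def
  set B := f 0 - Real.cos α * f 1 with hB
  have hs0 : 0 < Real.sin θ := Real.sin_pos_of_pos_of_lt_pi hθ0 (by linarith [Real.pi_pos])
  set Λ := 4 * Real.sin θ ^ 2 / mesh n ^ 2 with hΛ
  have hΛ0 : 0 < Λ := by positivity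
  have hαθ : α = 2 * θ / mesh n := by rw [hθ]; field_simp
  obtain ⟨hΛα, e8⟩ := discreteEigenvalue_bounds hθ0 hθ1 hh
  rw [← hαθ, ← hΛ] at hΛα e8
  have hG0 : 0 ≤ G := intervalIntegral.integral_nonneg zero_le_one fun t _ => abs_nonneg _
  have hJG : |J| ≤ G := by
    refine (intervalIntegral.abs_integral_le_integral_abs zero_le_one).trans ?_
    refine intervalIntegral.integral_mono_on zero_le_one
      (Continuous.intervalIntegrable (by fun_prop) _ _) (hc.abs.intervalIntegrable _ _)
      fun t _ => ?_
    rw [abs_mul]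
    exact mul_le_of_le_one_right (abs_nonneg _) (Real.abs_sin_le_one _)
  have hBf : |B| ≤ |f 0| + |f 1| := by
    refine (abs_sub _ _).trans ?_
    rw [abs_mul]
    linarith [mul_le_of_le_one_left (abs_nonneg (f 1)) (Real.abs_cos_le_one α)]
  have hkey : mesh n * S - I = mesh n / 2 * (Real.cos θ / Real.sin θ - 1 / θ) * B -
      (A - J) / Λ - J * (Λ⁻¹ - (α ^ 2)⁻¹) := by
    have e1 : mesh n * S = (Real.sin (2 * θ) / mesh n * B - A) / Λ := by
      rw [hA_def, hΛ, hB, eq_div_iff (by positivity)]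
      field_simp
      ring
    have e2 : I = (α * B - J) / α ^ 2 := by
      rw [eq_div_iff (by positivity)]; linarith
    have e3 : Real.sin (2 * θ) / mesh n / Λ = mesh n / 2 * (Real.cos θ / Real.sin θ) := by
      rw [Real.sin_two_mul, hΛ]; field_simp; ring
    have e4 : α / α ^ 2 = mesh n / 2 * (1 / θ) := by rw [hαθ]; field_simp
    rw [e1, e2]
    linear_combination B * e3 - B * e4
  have hκ1 : (1 : ℝ) ≤ (κ : ℝ) + 1 := by linarith [Nat.cast_nonneg (α := ℝ) κ]
  have b1 : |mesh n / 2 * (Real.cos θ / Real.sin θ - 1 / θ) * B| ≤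
      mesh n ^ 2 * ((κ : ℝ) + 1) * (|f 0| + |f 1|) := by
    rw [abs_mul, abs_mul, abs_of_pos (half_pos hh)]
    have e5 : mesh n / 2 * θ ≤ mesh n ^ 2 * ((κ : ℝ) + 1) := by
      have : mesh n / 2 * θ = mesh n ^ 2 * ((κ : ℝ) + 1) * (Real.pi / 4) := by
        rw [hθ, hα_def]; ring
      rw [this]
      exact mul_le_of_le_one_right (by positivity) (by linarith [Real.pi_le_four])
    exact mul_le_mul ((mul_le_mul_of_nonneg_left (inv_sub_cot_mem hθ0 hθ1)
      (half_pos hh).le).trans e5) hBf (abs_nonneg _) (by positivity)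
  have b2 : |(A - J) / Λ| ≤ 16 * mesh n ^ 2 * G := by
    rw [abs_div, abs_of_pos hΛ0, div_le_iff₀ hΛ0]
    calc |A - J| ≤ 4 * α ^ 2 * mesh n ^ 2 * G := hA
      _ = 16 * mesh n ^ 2 * G * (α ^ 2 / 4) := by ring
      _ ≤ _ := by gcongr
  have b3 : |J * (Λ⁻¹ - (α ^ 2)⁻¹)| ≤ 2 * mesh n ^ 2 * G := by
    rw [abs_mul, mul_comm]
    exact mul_le_mul e8 hJG (abs_nonneg _) (by positivity)
  rw [hkey]
  refine (abs_sub _ _).trans ((add_le_add_left (abs_sub _ _) _).trans ?_)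
  have hG1 : mesh n ^ 2 * G ≤ mesh n ^ 2 * ((κ : ℝ) + 1) * G :=
    mul_le_mul_of_nonneg_right (le_mul_of_one_le_right (by positivity) hκ1) hG0
  have hf0 : 0 ≤ mesh n ^ 2 * ((κ : ℝ) + 1) * (|f 0| + |f 1|) := by positivity
  have hG2 : 0 ≤ mesh n ^ 2 * G := by positivity
  calc _ ≤ mesh n ^ 2 * ((κ : ℝ) + 1) * (|f 0| + |f 1|) + 16 * mesh n ^ 2 * G +
        2 * mesh n ^ 2 * G := add_le_add (add_le_add b1 b2) b3
    _ ≤ 20 * (mesh n ^ 2 * ((κ : ℝ) + 1) * (|f 0| + |f 1|)) +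
        20 * (mesh n ^ 2 * ((κ : ℝ) + 1) * G) := by linarith
    _ = _ := by ring

theorem sq_endpoint_le (hf : ∀ t, HasDerivAt f (f' t) t) (hc : Continuous f') {p : ℝ}
    (hp : p ∈ Set.Icc (0 : ℝ) 1) :
    f p ^ 2 ≤ 2 * (∫ t in (0 : ℝ)..1, f t ^ 2) + 2 * ∫ t in (0 : ℝ)..1, f' t ^ 2 := by
  have hfc : Continuous f := continuous_iff_continuousAt.2 fun t => (hf t).continuousAt
  set G := ∫ t in (0 : ℝ)..1, f' t ^ 2 with hG
  have h2 : ∀ t ∈ Set.Icc (0 : ℝ) 1, |f t - f p| ≤ ∫ s in (0 : ℝ)..1, |f' s| := by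
    intro t ht
    rw [← intervalIntegral.integral_eq_sub_of_hasDerivAt (fun s _ => hf s)
      (hc.intervalIntegrable p t)]
    refine (intervalIntegral.norm_integral_le_integral_norm_uIoc (f := f')).trans ?_
    rw [intervalIntegral.integral_of_le zero_le_one]
    refine setIntegral_mono_set (hc.abs.integrableOn_Ioc (a := 0) (b := 1))
      (ae_of_all _ fun _ => abs_nonneg _) (Eventually.of_forall fun s hs => ?_)
    rcases Set.mem_uIoc.1 hs with hs | hs
    · exact ⟨hp.1.trans_lt hs.1, hs.2.trans ht.2⟩
    · exact ⟨ht.1.trans_lt hs.1, hs.2.trans hp.2⟩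
  have h3 : (∫ s in (0 : ℝ)..1, |f' s|) ^ 2 ≤ G := by
    refine (sq_integral_le_integral_sq hc.abs).trans ?_
    simp only [sq_abs, hG, le_refl]
  have h1 : ∀ t ∈ Set.Icc (0 : ℝ) 1, f p ^ 2 ≤ 2 * f t ^ 2 + 2 * G := by
    intro t ht
    have h4 : (f t - f p) ^ 2 ≤ (∫ s in (0 : ℝ)..1, |f' s|) ^ 2 := by
      rw [← sq_abs (f t - f p)]
      exact pow_le_pow_left₀ (abs_nonneg _) (h2 t ht) 2
    nlinarith [sq_nonneg (2 * f t - f p)]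
  have h5 := intervalIntegral.integral_mono_on zero_le_one
    (continuous_const.intervalIntegrable (μ := volume) 0 1)
    (Continuous.intervalIntegrable (by fun_prop) (μ := volume) 0 1) h1
  have h6 : Continuous fun t => 2 * f t ^ 2 := by fun_prop
  rw [intervalIntegral.integral_add (h6.intervalIntegrable _ _)
    (continuous_const.intervalIntegrable _ _), intervalIntegral.integral_const_mul,
    intervalIntegral.integral_const, intervalIntegral.integral_const] at h5
  simpa using h5

end OneDim

theorem integral_cube_one (g : (Fin 1 → ℝ) → ℝ) :
    ∫ x in cube 1, g x = ∫ t in (0 : ℝ)..1, g fun _ => t := by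
  have h := integral_cube_prod (d := 1) fun _ t => g fun _ => t
  have hx : ∀ x : Fin 1 → ℝ, (fun _ => x 0) = x := fun x => by
    ext j; rw [Subsingleton.elim j 0]
  simp only [Fin.prod_univ_one, hx] at h
  rw [h, integral_Icc_eq_integral_Ioc, intervalIntegral.integral_of_le zero_le_one]

theorem hasDerivAt_comp_diag {R : (Fin 1 → ℝ) → ℝ} (hR : Differentiable ℝ R) (t : ℝ) :
    HasDerivAt (fun t => R fun _ => t) (pd 1 0 R fun _ => t) t := by
  have h1 : HasDerivAt (fun t : ℝ => (fun _ : Fin 1 => t)) (Pi.single 0 1) t := by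
    rw [hasDerivAt_pi]
    intro j
    rw [Subsingleton.elim j 0, Pi.single_eq_same]
    exact hasDerivAt_id t
  exact (hR _).hasFDerivAt.comp_hasDerivAt t h1

theorem dInner_one_eq (n κ : ℕ) (R : (Fin 1 → ℝ) → ℝ) :
    dInner 1 n R (eigenFun 1 fun _ => κ) = √2 * (mesh n * ∑ i ∈ Finset.range n,
      (R fun _ => (i + 1 : ℕ) * mesh n) *
        Real.sin (((κ : ℝ) + 1) * Real.pi * ((i + 1 : ℕ) * mesh n))) := by
  rw [dInner, ← (Equiv.funUnique (Fin 1) (Fin n)).symm.sum_comp, pow_one, Finset.sum_range,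
    mul_left_comm]
  congr 1
  rw [Finset.mul_sum]
  refine Finset.sum_congr rfl fun i _ => ?_
  rw [eigenFun_eq_prod, Fin.prod_univ_one, sineMode, mul_left_comm]
  congr 2
  · congr 1
    ext j
    simp [gridPt]
  · simp [gridPt]

theorem integral_mul_eigenFun_one (κ : ℕ) (R : (Fin 1 → ℝ) → ℝ) :
    ∫ x in cube 1, R x * eigenFun 1 (fun _ => κ) x = √2 * ∫ t in (0 : ℝ)..1,
      (R fun _ => t) * Real.sin (((κ : ℝ) + 1) * Real.pi * t) := by
  rw [integral_cube_one, ← intervalIntegral.integral_const_mul]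
  refine intervalIntegral.integral_congr fun t _ => ?_
  simp only [eigenFun_eq_prod, Fin.prod_univ_one, sineMode]
  ring

theorem dInner_sub_integral_sq_le_one {R : (Fin 1 → ℝ) → ℝ} (hR : ContDiff ℝ 2 R) {n κ : ℕ}
    (hκ : κ < n) :
    (dInner 1 n R (eigenFun 1 fun _ => κ) -
        ∫ x in cube 1, R x * eigenFun 1 (fun _ => κ) x) ^ 2 ≤
      19200 * mesh n ^ 4 * ((κ : ℝ) + 1) ^ 2 * H2sq 1 R := by
  have hd : Continuous fun t : ℝ => (fun _ : Fin 1 => t) := by fun_prop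
  have hf := hasDerivAt_comp_diag (hR.differentiable (by norm_num))
  have hf' := hasDerivAt_comp_diag
    ((contDiff_pd (m := 1) hR (by norm_num) 0).differentiable (by norm_num))
  have hc' := (continuous_pd hR 0).comp hd
  have hc := (continuous_pd_pd hR 0 0).comp hd
  have h1 := abs_trapezoid_sin_sub_le hf hf' hc hκ
  have h2 := sq_endpoint_le hf hc' (p := 0) (by simp)
  have h3 := sq_endpoint_le hf hc' (p := 1) (by simp)
  have h4 := sq_integral_le_integral_sq hc.abs
  have h5 := sum_pd_pd_le_H2sq hR
  simp only [Fin.sum_univ_one, integral_cube_one] at h5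
  simp only [Function.comp_apply, sq_abs] at h4
  rw [dInner_one_eq, integral_mul_eigenFun_one, ← mul_sub, mul_pow,
    Real.sq_sqrt zero_le_two]
  have h6 := pow_le_pow_left₀ (abs_nonneg _) h1 2
  rw [sq_abs] at h6
  set a := R fun _ => 0
  set b := R fun _ => 1
  set G := ∫ t in (0 : ℝ)..1, |pd 1 0 (pd 1 0 R) fun _ => t|
  have h7 : (|a| + |b| + G) ^ 2 ≤ 3 * (a ^ 2 + b ^ 2 + G ^ 2) := by
    rw [← sq_abs a, ← sq_abs b]
    nlinarith [sq_nonneg (|a| - |b|), sq_nonneg (|a| - G), sq_nonneg (|b| - G)]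
  have h8 : a ^ 2 + b ^ 2 + G ^ 2 ≤ 8 * H2sq 1 R := by
    have : 0 ≤ ∫ t in (0 : ℝ)..1, (pd 1 0 (pd 1 0 R) fun _ => t) ^ 2 :=
      intervalIntegral.integral_nonneg zero_le_one fun _ _ => sq_nonneg _
    linarith
  calc _ ≤ 2 * (20 * mesh n ^ 2 * ((κ : ℝ) + 1) * (|a| + |b| + G)) ^ 2 := by gcongr
    _ = 800 * mesh n ^ 4 * ((κ : ℝ) + 1) ^ 2 * (|a| + |b| + G) ^ 2 := by ring
    _ ≤ 800 * mesh n ^ 4 * ((κ : ℝ) + 1) ^ 2 * (3 * (8 * H2sq 1 R)) := by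
      gcongr
      exact h7.trans (by linarith)
    _ = _ := by ring

theorem sum_inv_mul_dInner_sub_sq_le_one {R : (Fin 1 → ℝ) → ℝ} (hR : ContDiff ℝ 2 R) (n : ℕ) :
    ∑ k ∈ freqs 1 n, (1 + lamDisc 1 n k)⁻¹ *
        (dInner 1 n R (eigenFun 1 k) - ∫ x in cube 1, R x * eigenFun 1 k x) ^ 2 ≤
      19200 * mesh n ^ 3 * H2sq 1 R := by
  have hH := H2sq_nonneg R
  have hm := mesh_pos n
  have hterm : ∀ k ∈ freqs 1 n, (1 + lamDisc 1 n k)⁻¹ *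
      (dInner 1 n R (eigenFun 1 k) - ∫ x in cube 1, R x * eigenFun 1 k x) ^ 2 ≤
        19200 * mesh n ^ 4 * H2sq 1 R := by
    intro k hk
    have hk' : k = fun _ => k 0 := by ext j; rw [Subsingleton.elim j 0]
    have h1 := dInner_sub_integral_sq_le_one hR (mem_freqs.1 hk 0)
    rw [← hk'] at h1
    calc _ ≤ (((k 0 : ℝ) + 1) ^ 2)⁻¹ *
          (19200 * mesh n ^ 4 * ((k 0 : ℝ) + 1) ^ 2 * H2sq 1 R) :=
        mul_le_mul (inv_one_add_lamDisc_le hk 0) h1 (sq_nonneg _) (by positivity)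
      _ = _ := by field_simp
  refine (Finset.sum_le_card_nsmul _ _ _ hterm).trans ?_
  have hcard : (freqs 1 n).card = n := by simp [freqs]
  have hnm : (n : ℝ) * mesh n ≤ 1 := by linarith [mesh_mul n, add_one_mul (n : ℝ) (mesh n)]
  rw [hcard, nsmul_eq_mul]
  calc _ = (n : ℝ) * mesh n * (19200 * mesh n ^ 3 * H2sq 1 R) := by ring
    _ ≤ _ := mul_le_of_le_one_left (by positivity) hnm

theorem sum_fin_eq_sum_freqs (d n : ℕ) (R : (Fin d → ℝ) → ℝ) :
    ∑ k : Fin d → Fin n, (1 + lamD d n k)⁻¹ *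
        (dInner d n R (eigenFun d (fun j => (k j : ℕ)))) ^ 2 =
      ∑ k ∈ freqs d n, (1 + lamDisc d n k)⁻¹ * dInner d n R (eigenFun d k) ^ 2 := by
  refine Finset.sum_bij (fun k _ j => (k j : ℕ)) (fun k _ => mem_freqs.2 fun j => (k j).2)
    (fun k _ k' _ h => ?_) (fun k hk => ?_) fun k _ => rfl
  · ext j
    exact congrFun h j
  · exact ⟨fun j => ⟨k j, mem_freqs.1 hk j⟩, Finset.mem_univ _, rfl⟩

theorem exists_bound_sum_sub_tsum {d : ℕ} (hd : d = 1 ∨ d = 2 ∨ d = 3) (n : ℕ)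
    {R : (Fin d → ℝ) → ℝ} (hR : ContDiff ℝ 2 R) :
    |(∑ k ∈ freqs d n, (1 + lamDisc d n k)⁻¹ * dInner d n R (eigenFun d k) ^ 2) -
        ∑' k, (1 + lamC d k)⁻¹ * (∫ x in cube d, R x * eigenFun d k x) ^ 2| ≤
      10884 * mesh n ^ ((2 : ℝ) - (d : ℝ) / 2) * H2sq d R := by
  have hm := mesh_pos n
  have hH := H2sq_nonneg R
  have hρ : (mesh n ^ ((2 : ℝ) - (d : ℝ) / 2)) ^ 2 = mesh n ^ (4 - (d : ℝ)) := by
    rw [← Real.rpow_natCast, ← Real.rpow_mul hm.le]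
    congr 1
    push_cast
    ring
  have hmρ : mesh n ^ 2 ≤ mesh n ^ ((2 : ℝ) - (d : ℝ) / 2) := by
    rw [← Real.rpow_two]
    exact Real.rpow_le_rpow_of_exponent_ge hm (mesh_le_one n)
      (sub_le_self _ (by positivity))
  have h := abs_sum_sub_tsum_le (K := 19200) (by omega) n hR (Real.rpow_pos_of_pos hm _) hmρ
  norm_num only at h
  refine h ?_
  rw [hρ]
  rcases hd with rfl | rfl | rfl
  · refine (sum_inv_mul_dInner_sub_sq_le_one hR n).trans_eq ?_
    rw [← Real.rpow_natCast]
    norm_num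
  · refine (sum_inv_mul_dInner_sub_sq_le (by norm_num) n hR).trans ?_
    norm_num
    gcongr
    norm_num
  · refine (sum_inv_mul_dInner_sub_sq_le (by norm_num) n hR).trans ?_
    norm_num
    gcongr
    · norm_num
    · exact (pow_le_of_le_one hm.le (mesh_le_one n) two_ne_zero).trans_eq (by norm_num)

/-- **Deterministic part of the approximation of the `Φ`-norm (Lemma on the expectation).**
For `d ∈ {1,2,3}` there is a constant `C = C(d) > 0` such that for every `n ≥ 1`
(with `h = 1/(n+1)`), every `τ > 0` and every `R` twice continuously differentiable near
`[0,1]^d`,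
`|τ² ∑_{k∈{1,…,n}^d} (1+λ_k^{(h)})⁻¹ ⟨R,φ_k⟩_h² - ‖R‖_Φ²| ≤ C τ² h^{2-d/2} ‖R‖_{H²}²`. -/
theorem stmt_6 (d : ℕ) (hd : d = 1 ∨ d = 2 ∨ d = 3) :
    ∃ C : ℝ, 0 < C ∧
      ∀ (n : ℕ), 1 ≤ n → ∀ (τ : ℝ), 0 < τ →
      ∀ (R : (Fin d → ℝ) → ℝ), C2Nbhd d R →
      |τ ^ 2 * (∑ k : Fin d → Fin n, (1 + lamD d n k)⁻¹ *
            (dInner d n R (eigenFun d (fun j => (k j : ℕ)))) ^ 2) -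
          PhiSq d τ R| ≤
        C * τ ^ 2 * mesh n ^ ((2 : ℝ) - (d : ℝ) / 2) * H2sq d R := by
  refine ⟨10884, by norm_num, fun n _ τ _ R hR => ?_⟩
  obtain ⟨S, hS, hSR⟩ := hR.exists_contDiff
  rw [sum_fin_eq_sum_freqs]
  simp only [← dInner_congr hSR, ← PhiSq_congr hSR, ← H2sq_congr hSR]
  rw [PhiSq, ← mul_sub, abs_mul, abs_of_nonneg (sq_nonneg τ)]
  calc _ ≤ τ ^ 2 * (10884 * mesh n ^ ((2 : ℝ) - (d : ℝ) / 2) * H2sq d S) :=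
        mul_le_mul_of_nonneg_left (exists_bound_sum_sub_tsum hd n hS) (sq_nonneg τ)
    _ = _ := by ring
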